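/- arXiv:2003.06178 — 4 statements merged into one kernel-verified Lean document; each statement's English description precedes it below -/
import Mathlib

section
/- If D is a finite digraph with a root vertex r, then there is a spanning subdigraph F of D such that for every vertex v ≠ r, the local connectivity κ_D(r,v) equals κ_F(r,v) and also equals the in-degree of v in F. -/
/-!  Common framework: digraphs as edge sets on a vertex type, directed paths,
path-systems, separations, flames and largeness. -/

universe u

variable {V : Type u}

/-- A directed path in the digraph on `V` with edge set `E`, given by its
(nonempty, repetition-free) list of vertices `start :: rest`. -/
structure Dipath (E : Set (V × V)) : Type u where
  start : V
  rest : List V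
  chain : List.Chain (fun a b => (a, b) ∈ E) start rest
  nodup : (start :: rest).Nodup

namespace Dipath

variable {E : Set (V × V)}

/-- The list of vertices of the path. -/
def verts (p : Dipath E) : List V := p.start :: p.rest

/-- The terminal vertex of the path. -/
def last (p : Dipath E) : V := (p.start :: p.rest).getLast (List.cons_ne_nil _ _)

/-- The set of vertices of the path. -/
def support (p : Dipath E) : Set V := {v | v ∈ p.verts}

/-- The internal vertices of the path (all vertices except the first and the last). -/
def internal (p : Dipath E) : Set V := {v | v ∈ p.rest.dropLast}

/-- The list of (directed) edges of the path. -/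
def edges (p : Dipath E) : List (V × V) := p.verts.zip p.rest

/-- The set of edges of the path. -/
def edgeSet (p : Dipath E) : Set (V × V) := {e | e ∈ p.edges}

/-- The last edge of the path, if the path has at least one edge. -/
def lastEdge? (p : Dipath E) : Option (V × V) := p.edges.getLast?

end Dipath

section Defs

variable (E : Set (V × V))

/-- The set of ingoing edges of `v`. -/
def inEdges (v : V) : Set (V × V) := {e ∈ E | e.2 = v}

/-- The set of initial vertices of a set of paths. -/
def initVerts {E : Set (V × V)} (P : Set (Dipath E)) : Set V := Dipath.start '' P

/-- The set of terminal vertices of a set of paths. -/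
def termVerts {E : Set (V × V)} (P : Set (Dipath E)) : Set V := Dipath.last '' P

/-- The set of terminal edges of a set of paths. -/
def termEdges {E : Set (V × V)} (P : Set (Dipath E)) : Set (V × V) :=
  {e | ∃ p ∈ P, p.lastEdge? = some e}

/-- An `(r,v)`-path-system: a set of pairwise internally disjoint directed
paths from `r` to `v`. -/
def IsRVSystem (r v : V) (P : Set (Dipath E)) : Prop :=
  (∀ p ∈ P, p.start = r ∧ p.last = v) ∧
    P.Pairwise fun p q => p.support ∩ q.support ⊆ {r, v}

/-- An `(r,v)`-separation: a set of vertices avoiding `r` and `v` and meeting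
every directed path from `r` to `v`. -/
def IsSeparation (r v : V) (S : Set V) : Prop :=
  r ∉ S ∧ v ∉ S ∧ ∀ p : Dipath E, p.start = r → p.last = v → (p.support ∩ S).Nonempty

/-- A set of paths `P` and a vertex set `S` are orthogonal:  every path of `P`
meets `S` in exactly one vertex and every vertex of `S` lies on a path of `P`. -/
def Orthogonal {E : Set (V × V)} (P : Set (Dipath E)) (S : Set V) : Prop :=
  (∀ p ∈ P, ∃! x, x ∈ p.support ∩ S) ∧ ∀ x ∈ S, ∃ p ∈ P, x ∈ p.support

/-- An Erdős–Menger `(r,v)`-path-system: one orthogonal to some `(r,v)`-separation. -/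
def IsEMSystem (r v : V) (P : Set (Dipath E)) : Prop :=
  IsRVSystem E r v P ∧ ∃ S, IsSeparation E r v S ∧ Orthogonal P S

/-- An Erdős–Menger `(r,v)`-separation: one orthogonal to some `(r,v)`-path-system. -/
def IsEMSeparation (r v : V) (S : Set V) : Prop :=
  IsSeparation E r v S ∧ ∃ P : Set (Dipath E), IsRVSystem E r v P ∧ Orthogonal P S

/-- `𝒢_E(v)` (with root `r`): the collection of edge sets `I` that arise as the set of
terminal edges of an internally disjoint `(r,v)`-path-system in `E`. -/
def GSet (r v : V) : Set (Set (V × V)) :=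
  {I | ∃ P : Set (Dipath E), IsRVSystem E r v P ∧ termEdges P = I}

/-- A vertex-flame (with root `r`): for every `v ≠ r`, the whole in-edge set of `v`
is the terminal edge set of an internally disjoint `(r,v)`-path-system. -/
def IsFlame (r : V) : Prop := ∀ v, v ≠ r → inEdges E v ∈ GSet E r v

/-- `L` is `v`-large with respect to the digraph `E` rooted at `r`: `L` contains `rv`
whenever `E` does, and some Erdős–Menger `(r,v)`-path-system of `E - rv` lies in `L`. -/
def VLarge (r : V) (L : Set (V × V)) (v : V) : Prop :=
  ((r, v) ∈ E → (r, v) ∈ L) ∧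
    ∃ P : Set (Dipath (E \ {(r, v)})),
      IsEMSystem (E \ {(r, v)}) r v P ∧ ∀ p ∈ P, p.edgeSet ⊆ L

/-- `L` is large with respect to the digraph `E` rooted at `r`. -/
def Large (r : V) (L : Set (V × V)) : Prop := ∀ v, v ≠ r → VLarge E r L v

/-- An `(X,Y)`-path: from `X` to `Y`, internally disjoint from `X ∪ Y`. -/
def IsXYPath (X Y : Set V) (p : Dipath E) : Prop :=
  p.start ∈ X ∧ p.last ∈ Y ∧ ∀ w ∈ p.internal, w ∉ X ∪ Y

/-- An `(X,Y)`-path-system: pairwise disjoint `(X,Y)`-paths. -/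
def IsXYSystem (X Y : Set V) (P : Set (Dipath E)) : Prop :=
  (∀ p ∈ P, IsXYPath E X Y p) ∧ P.Pairwise fun p q => Disjoint p.support q.support

/-- `X` is joinable to `Y`: some `(X,Y)`-path-system covers `X` with its initial vertices. -/
def Joinable (X Y : Set V) : Prop :=
  ∃ P : Set (Dipath E), IsXYSystem E X Y P ∧ initVerts P = X

/-- `X` is incompressible to `Y`: `X` is joinable to `Y` and every witnessing
path-system covers `Y` with its terminal vertices. -/
def Incompressible (X Y : Set V) : Prop :=
  Joinable E X Y ∧
    ∀ P : Set (Dipath E), IsXYSystem E X Y P → initVerts P = X → termVerts P = Y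

/-- An `(X,Y)`-separation: a vertex set meeting every `(X,Y)`-path. -/
def IsXYSeparation (X Y : Set V) (S : Set V) : Prop :=
  ∀ p : Dipath E, IsXYPath E X Y p → (p.support ∩ S).Nonempty

/-- An Erdős–Menger `(X,Y)`-separation: one orthogonal to some `(X,Y)`-path-system. -/
def IsEMXYSeparation (X Y : Set V) (S : Set V) : Prop :=
  IsXYSeparation E X Y S ∧ ∃ P : Set (Dipath E), IsXYSystem E X Y P ∧ Orthogonal P S

/-- `X'` is `(X,Y)`-finitely extendable: every `O` with `X' ⊆ O ⊆ X` and `O \ X'`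
finite is joinable to `Y`. -/
def FinExtendable (X Y X' : Set V) : Prop :=
  X' ⊆ X ∧ ∀ O, X' ⊆ O → O ⊆ X → (O \ X').Finite → Joinable E O Y

/-- `S` separates the vertex `y` from `r`:  every directed path from `r` to `y` meets `S`. -/
def SeparatesFrom (r : V) (S : Set V) (y : V) : Prop :=
  ∀ p : Dipath E, p.start = r → p.last = y → (p.support ∩ S).Nonempty

/-- An `(X,y)`-path: from a vertex of `X` to `y`, internally disjoint from `X`. -/
def IsXyPath (X : Set V) (y : V) (p : Dipath E) : Prop :=
  p.start ∈ X ∧ p.last = y ∧ ∀ w ∈ p.internal, w ∉ X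

/-- An `(X,y)`-path-system: `(X,y)`-paths, pairwise disjoint except possibly at `y`. -/
def IsXySystem (X : Set V) (y : V) (P : Set (Dipath E)) : Prop :=
  (∀ p ∈ P, IsXyPath E X y p) ∧ P.Pairwise fun p q => p.support ∩ q.support ⊆ {y}

/-- An `(r,S)`-path: from `r` to a vertex of `S`, internally disjoint from `S`. -/
def IsRSPath (r : V) (S : Set V) (p : Dipath E) : Prop :=
  p.start = r ∧ p.last ∈ S ∧ ∀ w ∈ p.internal, w ∉ S

/-- An `(r,S)`-path-system: `(r,S)`-paths, pairwise disjoint apart from `r`. -/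
def IsRSSystem (r : V) (S : Set V) (P : Set (Dipath E)) : Prop :=
  (∀ p ∈ P, IsRSPath E r S p) ∧ P.Pairwise fun p q => p.support ∩ q.support ⊆ {r}

/-- `E` is a `G`-quasi-flame (with root `r`): for every `v ≠ r`, every set `I` of
ingoing edges of `v` with `I \ inEdges G v` finite lies in `𝒢_E(v)`. -/
def QuasiFlame (r : V) (G : Set (V × V)) : Prop :=
  ∀ v, v ≠ r → ∀ I, I ⊆ inEdges E v → (I \ inEdges G v).Finite → I ∈ GSet E r v

/-- The local connectivity `κ_E(r,v)`: the maximum size of an internally disjoint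
`(r,v)`-path-system. -/
noncomputable def kappa (r v : V) : ℕ :=
  sSup {n | ∃ P : Set (Dipath E), IsRVSystem E r v P ∧ P.Finite ∧ P.ncard = n}

end Defs

/-! ### Cuts -/

/-- A valid bi-set separating `v` from the root `r`. -/
def ValidCut (r v : V) (I O : Set V) : Prop := v ∈ I ∧ I ⊆ O ∧ r ∉ O

/-- The cut of a bi-set: its boundary vertices (as diagonal pairs) and its entering edges. -/
def cutSet (E : Set (V × V)) (I O : Set V) : Set (V × V) :=
  {e | (e.1 = e.2 ∧ e.1 ∈ O ∧ e.1 ∉ I) ∨ (e ∈ E ∧ e.1 ∉ O ∧ e.2 ∈ I)}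

theorem cutSet_mono {E F : Set (V × V)} (h : F ⊆ E) (I O : Set V) :
    cutSet F I O ⊆ cutSet E I O := by
  rintro e (he | ⟨h1, h2⟩)
  · exact Or.inl he
  · exact Or.inr ⟨h h1, h2⟩

theorem cutSet_submod [Finite V] (E : Set (V × V)) {I O I' O' : Set V} (h : I ⊆ O) (h' : I' ⊆ O') :
    (cutSet E (I ∩ I') (O ∩ O')).ncard + (cutSet E (I ∪ I') (O ∪ O')).ncard ≤
      (cutSet E I O).ncard + (cutSet E I' O').ncard := by
  rw [← Set.ncard_union_add_ncard_inter, ← Set.ncard_union_add_ncard_inter (cutSet E I O)]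
  apply Nat.add_le_add
  · apply Set.ncard_le_ncard _ (Set.toFinite _)
    rintro ⟨a, b⟩ hab
    have h1 := @h a; have h2 := @h' a; have h3 := @h b; have h4 := @h' b
    simp only [cutSet, Set.mem_union, Set.mem_inter_iff, Set.mem_setOf_eq] at hab ⊢
    grind
  · apply Set.ncard_le_ncard _ (Set.toFinite _)
    rintro ⟨a, b⟩ hab
    have h1 := @h a; have h2 := @h' a; have h3 := @h b; have h4 := @h' b
    simp only [cutSet, Set.mem_union, Set.mem_inter_iff, Set.mem_setOf_eq] at hab ⊢
    grind

/-! ### Crossing: easy half of Menger -/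

theorem crossing (E : Set (V × V)) {I O : Set V} (hincl : I ⊆ O) (l : List V) :
    ∀ a : V, List.IsChain (fun a b => (a, b) ∈ E) (a :: l) → a ∉ O →
      (a :: l).getLast (List.cons_ne_nil _ _) ∈ I →
      (∃ x ∈ a :: l, x ∈ O ∧ x ∉ I) ∨
      ∃ s c d t, a :: l = s ++ c :: d :: t ∧ (c, d) ∈ E ∧ c ∉ O ∧ d ∈ I := by
  induction l with
  | nil => intro a _ h1 h2; exact absurd (hincl h2) h1
  | cons b l ih =>
    intro a hc ha hl
    rw [List.isChain_cons_cons] at hc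
    by_cases hb : b ∈ O
    · by_cases hbI : b ∈ I
      · exact Or.inr ⟨[], a, b, l, rfl, hc.1, ha, hbI⟩
      · exact Or.inl ⟨b, by simp, hb, hbI⟩
    · rcases ih b hc.2 hb (by simpa using hl) with ⟨x, hx, h⟩ | ⟨s, c, d, t, h, h'⟩
      · exact Or.inl ⟨x, List.mem_cons_of_mem _ hx, h⟩
      · exact Or.inr ⟨a :: s, c, d, t, by simp [h], h'⟩

theorem crossing_path {E : Set (V × V)} {r v : V} {I O : Set V} (hX : ValidCut r v I O)
    (p : Dipath E) (hs : p.start = r) (hl : p.last = v) :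
    ∃ e ∈ cutSet E I O, e.1 ∈ p.support ∧ e.2 ∈ p.support ∧
      (e.1 = r → e.2 = v → p.rest = [v]) := by
  obtain ⟨st, rest, ch, nd⟩ := p
  obtain ⟨hv, hincl, hr⟩ := hX
  simp only [Dipath.last, Dipath.support, Dipath.verts, Set.mem_setOf_eq] at *
  subst hs
  rcases crossing E hincl rest st ch hr (by rw [hl]; exact hv) with
    ⟨x, hx, hxO, hxI⟩ | ⟨s, c, d, t, h, hcd, hc, hd⟩
  · refine ⟨(x, x), Or.inl ⟨rfl, hxO, hxI⟩, hx, hx, ?_⟩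
    intro h1 _
    simp only at h1
    exact absurd (h1 ▸ hxO) hr
  · refine ⟨(c, d), Or.inr ⟨hcd, hc, hd⟩, by rw [h]; simp, by rw [h]; simp, ?_⟩
    intro h1 h2
    simp only at h1 h2
    have hs0 : s = [] := by
      cases s with
      | nil => rfl
      | cons y s' =>
        simp only [List.cons_append, List.cons.injEq] at h
        rw [List.nodup_cons] at nd
        exact absurd (by rw [h.2, h1]; simp) nd.1
    subst hs0
    simp only [List.nil_append, List.cons.injEq] at h
    obtain ⟨_, h⟩ := h
    have ht : t = [] := by
      by_contra hne
      subst h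
      have hm : v ∈ t := by
        rw [← hl, List.getLast_cons (by simp), List.getLast_cons hne]
        exact List.getLast_mem _
      simp only [List.nodup_cons] at nd
      exact nd.2.1 (h2 ▸ hm)
    rw [h, ht, h2]

theorem system_le_cut [Finite V] {E : Set (V × V)} {r v : V} {I O : Set V} (hX : ValidCut r v I O)
    {P : Set (Dipath E)} (hP : IsRVSystem E r v P) :
    P.ncard ≤ (cutSet E I O).ncard := by
  classical
  have key : ∀ p : Dipath E, ∃ e : V × V, p ∈ P → (e ∈ cutSet E I O ∧ e.1 ∈ p.support ∧
      e.2 ∈ p.support ∧ (e.1 = r → e.2 = v → p.rest = [v])) := by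
    intro p
    by_cases hp : p ∈ P
    · obtain ⟨e, he⟩ := crossing_path hX p (hP.1 p hp).1 (hP.1 p hp).2
      exact ⟨e, fun _ => he⟩
    · exact ⟨(r, r), fun h => absurd h hp⟩
  choose f hf using key
  refine Set.ncard_le_ncard_of_injOn f (fun p hp => (hf p hp).1) ?_ (Set.toFinite _)
  intro p hp q hq hpq
  by_contra hne
  have hsub := hP.2 hp hq hne
  obtain ⟨h1, h2, h3, h4⟩ := hf p hp
  obtain ⟨g1, g2, g3, g4⟩ := hf q hq
  rw [← hpq] at g1 g2 g3 g4
  obtain ⟨hv, hincl, hr⟩ := hX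
  have k1 := hsub ⟨h2, g2⟩
  have k2 := hsub ⟨h3, g3⟩
  simp only [Set.mem_insert_iff, Set.mem_singleton_iff] at k1 k2
  rcases h1 with ⟨_, hO, hI⟩ | ⟨_, hO, hI⟩
  · rcases k1 with k | k
    · exact hr (k ▸ hO)
    · exact hI (k ▸ hv)
  · have e1 : (f p).1 = r := k1.resolve_right fun k => hO (k ▸ hincl hv)
    have e2 : (f p).2 = v := k2.resolve_left fun k => hr (hincl (k ▸ hI))
    have r1 := h4 e1 e2
    have r2 := g4 e1 e2
    have s1 := (hP.1 p hp).1
    have s2 := (hP.1 q hq).1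
    apply hne
    cases p; cases q
    simp_all

/-! ### Paths from reachability -/

theorem exists_path {R : V → V → Prop} {a u : V} (h : Relation.ReflTransGen R a u) :
    ∃ l : List V, List.IsChain R (a :: l) ∧ (a :: l).Nodup ∧
      (a :: l).getLast (List.cons_ne_nil _ _) = u := by
  induction h using Relation.ReflTransGen.head_induction_on with
  | refl => exact ⟨[], by simp, by simp, rfl⟩
  | @head a b hab _ ih =>
    obtain ⟨l, h1, h2, h3⟩ := ih
    by_cases ha : a ∈ b :: l
    · obtain ⟨s, t, hst⟩ := List.append_of_mem ha
      have hsuf : (a :: t) <:+ (b :: l) := ⟨s, hst.symm⟩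
      refine ⟨t, h1.suffix hsuf, h2.sublist hsuf.sublist, ?_⟩
      rw [← h3]
      simp only [hst]
      rw [List.getLast_append_of_ne_nil (by simp)]
    · refine ⟨b :: l, List.isChain_cons_cons.2 ⟨hab, h1⟩, List.nodup_cons.2 ⟨ha, h2⟩, ?_⟩
      rw [List.getLast_cons (by simp)]
      exact h3

theorem reach_of_chain {Q : Set (V × V)} {r : V} (t : List V) :
    ∀ x, List.IsChain (fun a b => (a, b) ∈ Q) (x :: t) → r ∉ x :: t →
      Relation.ReflTransGen (fun a b => (a, b) ∈ Q ∧ a ≠ r) x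
        ((x :: t).getLast (List.cons_ne_nil _ _)) := by
  induction t with
  | nil => intro x _ _; exact Relation.ReflTransGen.refl
  | cons y t ih =>
    intro x hc hr
    rw [List.isChain_cons_cons] at hc
    rw [List.getLast_cons (by simp)]
    simp only [List.mem_cons, not_or] at hr
    refine Relation.ReflTransGen.head ⟨hc.1, fun h => hr.1 h.symm⟩ (ih y hc.2 ?_)
    simp only [List.mem_cons, not_or]
    exact hr.2

/-- From a functional edge set, extract a path-system. -/
theorem system_of_functional [Finite V] {E Q : Set (V × V)} {r v : V} (hQE : Q ⊆ E) (hvr : v ≠ r)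
    (hout : ∀ x a b, x ≠ r → (x, a) ∈ Q → (x, b) ∈ Q → a = b)
    (hv : ∀ a, (v, a) ∉ Q)
    (hreach : ∀ u, (u, v) ∈ Q → Relation.ReflTransGen (fun a b => (a, b) ∈ Q) r u) :
    ∃ P : Set (Dipath E), IsRVSystem E r v P ∧ P.Finite ∧ P.ncard = (inEdges Q v).ncard := by
  classical
  have key : ∀ u : {u // (u, v) ∈ Q}, ∃ l : List V, List.IsChain (fun a b => (a, b) ∈ Q) (r :: l) ∧
      (r :: l).Nodup ∧ (r :: l).getLast (List.cons_ne_nil _ _) = u.1 :=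
    fun u => exists_path (hreach u.1 u.2)
  choose l h1 h2 h3 using key
  have hvl : ∀ u, v ∉ r :: l u := by
    intro u hm
    obtain ⟨s, t, hst⟩ := List.append_of_mem hm
    have hc : List.IsChain (fun a b => (a, b) ∈ Q) (v :: t) := (h1 u).suffix ⟨s, hst.symm⟩
    cases t with
    | nil =>
      have h := h3 u
      simp only [hst] at h
      rw [List.getLast_concat] at h
      have := u.2
      rw [← h] at this
      exact hv _ this
    | cons y t => exact hv _ (List.isChain_cons_cons.1 hc).1
  have hchain : ∀ u, List.IsChain (fun a b => (a, b) ∈ E) (r :: (l u ++ [v])) := by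
    intro u
    rw [← List.cons_append, List.isChain_append]
    refine ⟨(h1 u).imp fun a b h => hQE h, by simp, ?_⟩
    intro x hx y hy
    rw [List.getLast?_eq_getLast_of_ne_nil (List.cons_ne_nil _ _), h3 u] at hx
    simp only [Option.mem_def, Option.some.injEq, List.head?_cons] at hx hy
    rw [← hx, ← hy]
    exact hQE u.2
  have hnd : ∀ u, (r :: (l u ++ [v])).Nodup := by
    intro u
    rw [← List.cons_append, List.nodup_append]
    refine ⟨h2 u, by simp, ?_⟩
    intro a ha b hb hab
    simp only [List.mem_singleton] at hb
    exact hvl u (hb ▸ hab ▸ ha)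
  let path : {u // (u, v) ∈ Q} → Dipath E := fun u => ⟨r, l u ++ [v], hchain u, hnd u⟩
  have hinj : Function.Injective path := by
    intro u u' h
    have hl : l u ++ [v] = l u' ++ [v] := congrArg Dipath.rest h
    have hl' : l u = l u' := List.append_cancel_right hl
    apply Subtype.ext
    rw [← h3 u, ← h3 u']
    simp only [hl']
  have hmem : ∀ u x, x ∈ (path u).support → x ≠ r → x ≠ v →
      Relation.ReflTransGen (fun a b => (a, b) ∈ Q ∧ a ≠ r) x u.1 := by
    intro u x hx hxr hxv
    have hxl : x ∈ l u := by
      have : x ∈ r :: (l u ++ [v]) := hx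
      simpa [hxr, hxv] using this
    obtain ⟨s, t, hst⟩ := List.append_of_mem hxl
    have hsuf : (x :: t) <:+ (r :: l u) := ⟨r :: s, by simp [hst]⟩
    have hr : r ∉ x :: t := by
      intro hm
      refine (List.nodup_cons.1 (h2 u)).1 ?_
      rw [hst]
      exact List.mem_append_right _ hm
    have := reach_of_chain t x ((h1 u).suffix hsuf) hr
    convert this using 1
    rw [← h3 u]
    simp only [hst]
    rw [List.getLast_cons (by simp), List.getLast_append_of_ne_nil (by simp)]
  have huniq : ∀ u u' : V, (u, v) ∈ Q → (u', v) ∈ Q → u ≠ r →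
      Relation.ReflTransGen (fun a b => (a, b) ∈ Q ∧ a ≠ r) u u' → u = u' := by
    intro u u' hu hu' hur h
    rcases Relation.ReflTransGen.cases_head h with h | ⟨c, hc, h⟩
    · exact h
    · have : c = v := hout u c v hur hc.1 hu
      subst this
      rcases Relation.ReflTransGen.cases_head h with h | ⟨d, hd, _⟩
      · rw [← h] at hu'
        exact absurd hu' (hv _)
      · exact absurd hd.1 (hv _)
  refine ⟨Set.range path, ⟨?_, ?_⟩, Set.toFinite _, ?_⟩
  · rintro _ ⟨u, rfl⟩
    refine ⟨rfl, ?_⟩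
    simp [path, Dipath.last]
  · rintro _ ⟨u, rfl⟩ _ ⟨u', rfl⟩ hne x ⟨hx, hx'⟩
    simp only [Set.mem_insert_iff, Set.mem_singleton_iff]
    by_contra hcon
    rw [not_or] at hcon
    apply hne
    congr 1
    apply Subtype.ext
    have q1 := hmem u x hx hcon.1 hcon.2
    have q2 := hmem u' x hx' hcon.1 hcon.2
    have hur : ∀ u, x ∈ (path u).support → u.1 ≠ r := by
      intro u hx hur
      have hxl : x ∈ l u := by
        have : x ∈ r :: (l u ++ [v]) := hx
        simpa [hcon.1, hcon.2] using this
      have hn : l u ≠ [] := List.ne_nil_of_mem hxl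
      have h := h3 u
      rw [List.getLast_cons hn, hur] at h
      exact (List.nodup_cons.1 (h2 u)).1 (h ▸ List.getLast_mem hn)
    have hru : Relator.RightUnique (fun a b => (a, b) ∈ Q ∧ a ≠ r) :=
      fun a b c hb hc => hout a b c hb.2 hb.1 hc.1
    rcases Relation.ReflTransGen.total_of_right_unique hru q1 q2 with h | h
    · exact huniq _ _ u.2 u'.2 (hur u hx) h
    · exact (huniq _ _ u'.2 u.2 (hur u' hx') h).symm
  · rw [Set.ncard_range_of_injective hinj]
    rw [← Nat.card_coe_set_eq]
    refine Nat.card_congr ⟨fun u => ⟨(u.1, v), u.2, rfl⟩,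
      fun e => ⟨e.1.1, ?_⟩, fun u => rfl, ?_⟩
    · obtain ⟨⟨a, b⟩, h, hb⟩ := e
      simp only at hb
      subst hb
      exact h
    · rintro ⟨⟨a, b⟩, h, hb⟩
      simp only at hb
      subst hb
      rfl

/-! ### Menger -/

theorem menger_core [Finite V] (E : Set (V × V)) {r v : V} (hvr : v ≠ r) (k : ℕ)
    (hk : ∀ I O, ValidCut r v I O → k ≤ (cutSet E I O).ncard) :
    ∃ Q ⊆ E, (∀ I O, ValidCut r v I O → k ≤ (cutSet Q I O).ncard) ∧
      k ≤ (inEdges Q v).ncard ∧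
      ∃ P : Set (Dipath E), IsRVSystem E r v P ∧ P.Finite ∧ P.ncard = (inEdges Q v).ncard := by
  classical
  obtain ⟨Q, ⟨hQE, hQk⟩, hmin⟩ :=
    (Set.toFinite {Q : Set (V × V) | Q ⊆ E ∧
      ∀ I O, ValidCut r v I O → k ≤ (cutSet Q I O).ncard}).exists_minimal ⟨E, subset_rfl, hk⟩
  have tight : ∀ a b, (a, b) ∈ Q → ∃ I O, ValidCut r v I O ∧ (cutSet Q I O).ncard = k ∧
      a ∉ O ∧ b ∈ I := by
    intro a b hab
    by_contra hcon
    push Not at hcon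
    have : Q ≤ Q \ {(a, b)} := by
      apply hmin ⟨Set.diff_subset.trans hQE, ?_⟩ Set.diff_subset
      intro I O hX
      by_cases hin : a ∉ O ∧ b ∈ I
      · have hlt : k < (cutSet Q I O).ncard :=
          lt_of_le_of_ne (hQk I O hX) fun h => hcon I O hX h.symm hin.1 hin.2
        have : (cutSet Q I O).ncard ≤ (insert (a, b) (cutSet (Q \ {(a, b)}) I O)).ncard := by
          apply Set.ncard_le_ncard _ (Set.toFinite _)
          rintro e (he | he)
          · exact Or.inr (Or.inl he)
          · by_cases h : e = (a, b)
            · exact Or.inl h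
            · exact Or.inr (Or.inr ⟨⟨he.1, h⟩, he.2⟩)
        have := Set.ncard_insert_le (a, b) (cutSet (Q \ {(a, b)}) I O)
        omega
      · refine (hQk I O hX).trans (Set.ncard_le_ncard ?_ (Set.toFinite _))
        rintro e (he | he)
        · exact Or.inl he
        · refine Or.inr ⟨⟨he.1, ?_⟩, he.2⟩
          rintro rfl
          exact hin he.2
    exact (this hab).2 rfl
  refine ⟨Q, hQE, hQk, ?_, ?_⟩
  · refine (hQk {v} {v} ⟨rfl, subset_rfl, fun h => hvr h.symm⟩).trans
      (Set.ncard_le_ncard ?_ (Set.toFinite _))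
    rintro e (he | he)
    · exact absurd he.2.1 he.2.2
    · exact ⟨he.1, he.2.2⟩
  apply system_of_functional hQE hvr
  · intro x a b hx ha hb
    by_contra hab
    obtain ⟨I, O, hX, hc, hxO, haI⟩ := tight x a ha
    obtain ⟨I', O', hX', hc', hxO', hbI'⟩ := tight x b hb
    have hsub := cutSet_submod Q hX.2.1 hX'.2.1
    have hi := hQk (I ∩ I') (O ∩ O') ⟨⟨hX.1, hX'.1⟩, Set.inter_subset_inter hX.2.1 hX'.2.1,
      fun h => hX.2.2 h.1⟩
    have hu := hQk (I ∪ I') (insert x (O ∪ O')) ⟨Or.inl hX.1,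
      (Set.union_subset_union hX.2.1 hX'.2.1).trans (Set.subset_insert _ _), by
        rintro (h | h | h)
        · exact hx h.symm
        · exact hX.2.2 h
        · exact hX'.2.2 h⟩
    have hA : (cutSet Q (I ∪ I') (insert x (O ∪ O'))) ⊆
        insert (x, x) (cutSet Q (I ∪ I') (O ∪ O') \ {(x, a), (x, b)}) := by
      rintro ⟨c, d⟩ h
      simp only [cutSet, Set.mem_insert_iff, Set.mem_diff, Set.mem_setOf_eq, Prod.mk.injEq,
        Set.mem_singleton_iff, Set.mem_union] at h ⊢
      have h1 := @hX.2.1 c; have h2 := @hX'.2.1 c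
      have h1 := @hX.2.1 a; have h2 := @hX'.2.1 b
      grind
    have hB := Set.ncard_le_ncard hA (Set.toFinite _)
    have hC := Set.ncard_insert_le (x, x) (cutSet Q (I ∪ I') (O ∪ O') \ {(x, a), (x, b)})
    have hD : ({(x, a), (x, b)} : Set (V × V)) ⊆ cutSet Q (I ∪ I') (O ∪ O') := by
      rintro e (rfl | rfl)
      · exact Or.inr ⟨ha, by rintro (h | h); exacts [hxO h, hxO' h], Or.inl haI⟩
      · exact Or.inr ⟨hb, by rintro (h | h); exacts [hxO h, hxO' h], Or.inr hbI'⟩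
    have hE := Set.ncard_diff_add_ncard_of_subset hD (Set.toFinite _)
    rw [Set.ncard_pair (by simpa using hab)] at hE
    omega
  · intro a ha
    obtain ⟨I, O, hX, _, hxO, _⟩ := tight v a ha
    exact hxO (hX.2.1 hX.1)
  · intro u hu
    by_contra hcon
    obtain ⟨I, O, hX, hc, huO, hvI⟩ := tight u v hu
    set Z : Set V := {x | Relation.ReflTransGen (fun a b => (a, b) ∈ Q) x u} with hZ
    have hback : ∀ a b, (a, b) ∈ Q → b ∈ Z → a ∈ Z := fun a b h h' =>
      Relation.ReflTransGen.head h h'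
    have huZ : u ∈ Z := Relation.ReflTransGen.refl
    have h1 := hQk (I ∪ Z) (O ∪ Z) ⟨Or.inl hX.1, Set.union_subset_union_left _ hX.2.1, by
      rintro (h | h)
      · exact hX.2.2 h
      · exact hcon h⟩
    have h2 : cutSet Q (I ∪ Z) (O ∪ Z) ⊂ cutSet Q I O := by
      refine Set.ssubset_iff_of_subset ?_ |>.2 ⟨(u, v), Or.inr ⟨hu, huO, hvI⟩, ?_⟩
      · rintro ⟨c, d⟩ h
        have := hback c d
        simp only [cutSet, Set.mem_union, Set.mem_setOf_eq] at h ⊢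
        grind
      · rintro (h | h)
        · have := h.1
          simp only at this
          subst this
          exact huO (hX.2.1 hvI)
        · exact h.2.1 (Or.inr huZ)
    have h3 := Set.ncard_lt_ncard h2 (Set.toFinite _)
    omega

theorem menger [Finite V] (E : Set (V × V)) {r v : V} (hvr : v ≠ r) :
    (∀ I O, ValidCut r v I O → kappa E r v ≤ (cutSet E I O).ncard) ∧
    (∃ I O, ValidCut r v I O ∧ (cutSet E I O).ncard = kappa E r v) ∧
    ∃ Q ⊆ E, (∀ I O, ValidCut r v I O → kappa E r v ≤ (cutSet Q I O).ncard) ∧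
      (inEdges Q v).ncard = kappa E r v := by
  classical
  have hne : ∃ n, ∃ I O, ValidCut r v I O ∧ (cutSet E I O).ncard = n :=
    ⟨_, {v}, {v}, ⟨rfl, subset_rfl, fun h => hvr h.symm⟩, rfl⟩
  obtain ⟨I, O, hX, hk⟩ := Nat.find_spec hne
  have hmin : ∀ I O, ValidCut r v I O → Nat.find hne ≤ (cutSet E I O).ncard :=
    fun I O h => Nat.find_min' hne ⟨I, O, h, rfl⟩
  generalize Nat.find hne = k at hk hmin
  obtain ⟨Q, hQE, hQk, hkin, P, hP, hPf, hPn⟩ := menger_core E hvr k hmin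
  have hup : ∀ n ∈ {n | ∃ P : Set (Dipath E), IsRVSystem E r v P ∧ P.Finite ∧ P.ncard = n},
      n ≤ k := by
    rintro n ⟨P, hP, _, rfl⟩
    rw [← hk]
    exact system_le_cut hX hP
  have hmem : (inEdges Q v).ncard ∈
      {n | ∃ P : Set (Dipath E), IsRVSystem E r v P ∧ P.Finite ∧ P.ncard = n} :=
    ⟨P, hP, hPf, hPn⟩
  have hkap : kappa E r v = k := by
    apply le_antisymm
    · exact csSup_le ⟨_, hmem⟩ hup
    · exact hkin.trans (le_csSup ⟨k, hup⟩ hmem)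
  rw [hkap]
  exact ⟨hmin, ⟨I, O, hX, hk⟩, Q, hQE, hQk, le_antisymm (hup _ hmem) hkin⟩

theorem kappa_mono [Finite V] {E F : Set (V × V)} (h : F ⊆ E) {r v : V} (hvr : v ≠ r) :
    kappa F r v ≤ kappa E r v := by
  obtain ⟨I, O, hX, hk⟩ := (menger E hvr).2.1
  rw [← hk]
  exact ((menger F hvr).1 I O hX).trans
    (Set.ncard_le_ncard (cutSet_mono h I O) (Set.toFinite _))

/-- Deleting an in-edge of `v` without decreasing `κ(v)` preserves every local connectivity. -/
theorem kappa_delete [Finite V] {F : Set (V × V)} {r u v : V} (hvr : v ≠ r) (he : (u, v) ∈ F)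
    (hv : kappa F r v ≤ kappa (F \ {(u, v)}) r v) {w : V} (hwr : w ≠ r) :
    kappa F r w ≤ kappa (F \ {(u, v)}) r w := by
  set F' := F \ {(u, v)} with hF'
  have hsub : F' ⊆ F := Set.diff_subset
  by_contra hlt
  push Not at hlt
  obtain ⟨I, O, hX, hk⟩ := (menger F' hwr).2.1
  obtain ⟨J, U, hY, hkY⟩ := (menger F hvr).2.1
  have hYr := (menger F' hvr).1 J U hY
  have hnot : ¬ (u ∉ U ∧ v ∈ J) := by
    intro h
    have : cutSet F' J U ⊂ cutSet F J U := by
      refine Set.ssubset_iff_of_subset (cutSet_mono hsub _ _) |>.2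
        ⟨(u, v), Or.inr ⟨he, h⟩, ?_⟩
      rintro (h' | h')
      · have := h'.1
        simp only at this
        subst this
        exact h.1 (hY.2.1 h.2)
      · exact h'.1.2 rfl
    have := Set.ncard_lt_ncard this (Set.toFinite _)
    omega
  have heq : ∀ A B : Set V, ¬ (u ∉ B ∧ v ∈ A) → cutSet F A B = cutSet F' A B := by
    intro A B h
    apply subset_antisymm _ (cutSet_mono hsub _ _)
    rintro e (h' | h')
    · exact Or.inl h'
    · refine Or.inr ⟨⟨h'.1, ?_⟩, h'.2⟩
      rintro rfl
      exact h h'.2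
  have hXw := (menger F hwr).1 I O hX
  have hvI : v ∈ I := by
    by_contra h
    rw [heq I O fun h' => h h'.2] at hXw
    omega
  have hYe := heq J U hnot
  have hs := cutSet_submod F' hX.2.1 hY.2.1
  have hi := (menger F' hvr).1 (I ∩ J) (O ∩ U) ⟨⟨hvI, hY.1⟩,
    Set.inter_subset_inter hX.2.1 hY.2.1, fun h => hX.2.2 h.1⟩
  have hu := (menger F hwr).1 (I ∪ J) (O ∪ U) ⟨Or.inl hX.1,
    Set.union_subset_union hX.2.1 hY.2.1, by
      rintro (h | h)
      · exact hX.2.2 h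
      · exact hY.2.2 h⟩
  rw [heq (I ∪ J) (O ∪ U) fun h => hnot ⟨fun h' => h.1 (Or.inr h'), hY.1⟩] at hu
  rw [hYe] at hkY
  omega

/-- **Lovász' theorem.** Every finite rooted digraph has a spanning subdigraph `F`
preserving all local connectivities from the root while `|in_F(v)| = κ_D(r,v)`. -/
theorem stmt0 {V : Type u} [Fintype V] (E : Set (V × V)) (r : V) :
    ∃ F ⊆ E, ∀ v, v ≠ r →
      kappa E r v = kappa F r v ∧ kappa F r v = (inEdges F v).ncard := by
  obtain ⟨F, ⟨hFE, hFk⟩, hmin⟩ :=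
    (Set.toFinite {F : Set (V × V) | F ⊆ E ∧ ∀ w, w ≠ r → kappa E r w ≤ kappa F r w}).exists_minimal
      ⟨E, subset_rfl, fun _ _ => le_rfl⟩
  refine ⟨F, hFE, fun v hvr => ⟨le_antisymm (hFk v hvr) (kappa_mono hFE hvr), ?_⟩⟩
  obtain ⟨hle, _, Q, hQF, hQk, hQn⟩ := menger F hvr
  have hsub : inEdges Q v ⊆ inEdges F v := fun e he => ⟨hQF he.1, he.2⟩
  rw [← hQn]
  by_contra hne
  have hss : ¬ inEdges F v ⊆ inEdges Q v := fun h => hne (by rw [subset_antisymm hsub h])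
  obtain ⟨⟨u, v'⟩, he, heQ⟩ := Set.not_subset.1 hss
  have hv' : v' = v := he.2
  subst hv'
  have hQ' : Q ⊆ F \ {(u, v')} := by
    intro e h
    refine ⟨hQF h, ?_⟩
    rintro rfl
    exact heQ ⟨h, rfl⟩
  have hkv : kappa F r v' ≤ kappa (F \ {(u, v')}) r v' := by
    obtain ⟨I, O, hX, hk⟩ := (menger (F \ {(u, v')}) hvr).2.1
    rw [← hk]
    exact (hQk I O hX).trans (Set.ncard_le_ncard (cutSet_mono hQ' I O) (Set.toFinite _))
  have hle' : F ≤ F \ {(u, v')} :=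
    hmin ⟨Set.diff_subset.trans hFE, fun w hw => (hFk w hw).trans (kappa_delete hvr he.1 hkv hw)⟩
      Set.diff_subset
  exact (hle' he.1).2 rfl
end

section
/- Let D be a finite digraph rooted at r, and let F be a spanning subdigraph of D that is a vertex-flame. Then there exists a spanning subdigraph F* of D with F ⊆ F* such that F* is a vertex-flame and for every vertex v ≠ r, κ_{F*}(r,v) = κ_D(r,v). -/
/-!  Common framework: digraphs as edge sets on a vertex type, directed paths,
path-systems, separations, flames and largeness. -/

universe u

variable {V : Type u}

/-! ## Cuts -/

namespace FlameAux

/-- The vertex cut determined by a set `X` (not containing the root). -/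
def cut (r : V) (L : Set (V × V)) (X : Set V) : Set V :=
  {x | (x ∉ X ∧ x ≠ r ∧ ∃ y ∈ X, (x, y) ∈ L) ∨ (x ∈ X ∧ (r, x) ∈ L)}

lemma cut_mono (r : V) {L M : Set (V × V)} (h : L ⊆ M) (X : Set V) : cut r L X ⊆ cut r M X := by
  rintro x (⟨h1, h2, y, hy, h3⟩ | ⟨h1, h2⟩)
  · exact Or.inl ⟨h1, h2, y, hy, h h3⟩
  · exact Or.inr ⟨h1, h h2⟩

lemma cut_submod [Finite V] (r : V) (L : Set (V × V)) (X Y : Set V) :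
    (cut r L (X ∩ Y)).ncard + (cut r L (X ∪ Y)).ncard ≤ (cut r L X).ncard + (cut r L Y).ncard := by
  rw [← Set.ncard_union_add_ncard_inter, ← Set.ncard_union_add_ncard_inter (cut r L X)]
  apply add_le_add <;> apply Set.ncard_le_ncard _ (Set.toFinite _)
  · intro x hx
    simp only [cut, Set.mem_union, Set.mem_inter_iff, Set.mem_ofPred_eq] at hx ⊢
    grind
  · intro x hx
    simp only [cut, Set.mem_union, Set.mem_inter_iff, Set.mem_ofPred_eq] at hx ⊢
    grind

/-- A strict version of submodularity. -/
lemma cut_submod_lt [Finite V] (r : V) (L : Set (V × V)) (X Y : Set V) (a : V)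
    (haX : a ∈ cut r L X) (haY : a ∈ cut r L Y) (ha : a ∉ cut r L (X ∩ Y)) :
    (cut r L (X ∩ Y)).ncard + (cut r L (X ∪ Y)).ncard < (cut r L X).ncard + (cut r L Y).ncard := by
  rw [← Set.ncard_union_add_ncard_inter, ← Set.ncard_union_add_ncard_inter (cut r L X)]
  apply add_lt_add_of_le_of_lt
  · apply Set.ncard_le_ncard _ (Set.toFinite _)
    intro x hx
    simp only [cut, Set.mem_union, Set.mem_inter_iff, Set.mem_ofPred_eq] at hx ⊢
    grind
  · apply Set.ncard_lt_ncard _ (Set.toFinite _)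
    refine ⟨?_, fun h => ha (h ⟨haX, haY⟩).1⟩
    intro x hx
    simp only [cut, Set.mem_inter_iff, Set.mem_union, Set.mem_ofPred_eq] at hx ⊢
    grind

open Classical in
/-- The cut vertex representing an edge. -/
noncomputable def rep (r : V) (e : V × V) : V := if e.1 = r then e.2 else e.1

lemma cut_diff_le [Finite V] (r : V) (L : Set (V × V)) (e : V × V) (X : Set V) :
    (cut r L X).ncard ≤ (cut r (L \ {e}) X).ncard + 1 := by
  have : cut r L X ⊆ insert (rep r e) (cut r (L \ {e}) X) := by
    obtain ⟨a, b⟩ := e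
    intro x hx
    simp only [cut, rep, Set.mem_insert_iff, Set.mem_ofPred_eq, Set.mem_sdiff,
      Set.mem_singleton_iff, Prod.mk.injEq] at hx ⊢
    grind
  exact (Set.ncard_le_ncard this (Set.toFinite _)).trans (Set.ncard_insert_le _ _)

lemma crit [Finite V] {r : V} {L : Set (V × V)} {u v : V} {X : Set V} (hr : r ∉ X)
    (h : (cut r (L \ {(u, v)}) X).ncard < (cut r L X).ncard) :
    (u, v) ∈ L ∧ v ∈ X ∧ u ∉ X ∧ (u ≠ r → ∀ y ∈ X, (u, y) ∈ L → y = v) := by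
  by_contra hc
  apply absurd h (not_lt.mpr _)
  apply Set.ncard_le_ncard _ (Set.toFinite _)
  intro x hx
  simp only [cut, Set.mem_ofPred_eq, Set.mem_sdiff,
      Set.mem_singleton_iff, Prod.mk.injEq] at hx ⊢
  grind

/-- Every cut separating `v` from `r` has at least `k` elements. -/
def Conn (r : V) (L : Set (V × V)) (v : V) (k : ℕ) : Prop :=
  ∀ X : Set V, v ∈ X → r ∉ X → k ≤ (cut r L X).ncard

lemma Conn.mono {r : V} {L M : Set (V × V)} [Finite V] {v : V} {k : ℕ} (h : Conn r L v k)
    (hLM : L ⊆ M) : Conn r M v k := fun X hv hr =>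
  (h X hv hr).trans (Set.ncard_le_ncard (cut_mono r hLM X) (Set.toFinite _))

/-- Deleting an edge into `v` that does not hurt `v` does not hurt anybody. -/
lemma Conn.delete [Finite V] {r : V} {L : Set (V × V)} {u v w : V} {k l : ℕ}
    (X : Set V) (hvX : v ∈ X) (hrX : r ∉ X) (hX : (cut r L X).ncard = k)
    (hv : Conn r (L \ {(u, v)}) v k) (hw : Conn r L w l) :
    Conn r (L \ {(u, v)}) w l := by
  intro Y hwY hrY
  by_contra hlt
  push Not at hlt
  have h1 := hw Y hwY hrY
  obtain ⟨-, hvY, -, -⟩ := crit hrY (hlt.trans_le h1)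
  have h2 := hv (X ∩ Y) ⟨hvX, hvY⟩ (fun h => hrX h.1)
  have h3 := hv X hvX hrX
  have h4 : (cut r (L \ {(u, v)}) X).ncard ≤ (cut r L X).ncard :=
    Set.ncard_le_ncard (cut_mono r Set.sdiff_subset X) (Set.toFinite _)
  have h5 := cut_submod r (L \ {(u, v)}) X Y
  have h6 := hw (X ∪ Y) (Or.inr hwY) (by rintro (h | h) <;> contradiction)
  have heq : cut r (L \ {(u, v)}) X = cut r L X :=
    Set.eq_of_subset_of_ncard_le (cut_mono r Set.sdiff_subset X) (by omega) (Set.toFinite _)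
  have h7 : cut r L (X ∪ Y) ⊆ cut r (L \ {(u, v)}) (X ∪ Y) := by
    intro x hx
    have hx' := Set.ext_iff.mp heq x
    have hv' := Set.ext_iff.mp heq v
    simp only [cut, Set.mem_ofPred_eq, Set.mem_sdiff, Set.mem_union,
      Set.mem_singleton_iff, Prod.mk.injEq] at hx hx' hv' ⊢
    grind
  have h8 := Set.ncard_le_ncard h7 (Set.toFinite _)
  omega

/-- If all in-edges of `v` outside `F` are critical, the in-degree is at most the connectivity. -/
lemma indeg_le [Finite V] {r : V} {L F : Set (V × V)} {v : V} {k : ℕ} (hFL : F ⊆ L)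
    (hL : Conn r L v k) (X₀ : Set V) (hvX : v ∈ X₀) (hrX : r ∉ X₀) (hX₀ : (cut r L X₀).ncard = k)
    (hF : Conn r F v (inEdges F v).ncard)
    (hcrit : ∀ e ∈ inEdges L v \ F, ¬ Conn r (L \ {e}) v k) :
    (inEdges L v).ncard ≤ k := by
  obtain ⟨X, hX⟩ := exists_minimal_of_wellFoundedLT
    (fun X : Set V => v ∈ X ∧ r ∉ X ∧ (cut r L X).ncard = k) ⟨X₀, hvX, hrX, hX₀⟩
  obtain ⟨⟨hvX, hrX, hXk⟩, hmin⟩ := hX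
  have hsub : ∀ Y, v ∈ Y → r ∉ Y → (cut r L Y).ncard = k → X ⊆ Y := by
    intro Y hvY hrY hYk
    have h1 := cut_submod r L X Y
    have h2 := hL (X ∩ Y) ⟨hvX, hvY⟩ (fun h => hrX h.1)
    have h3 := hL (X ∪ Y) (Or.inl hvX) (by rintro (h | h) <;> contradiction)
    have h4 : X ⊆ X ∩ Y := hmin (y := X ∩ Y)
      (show v ∈ X ∩ Y ∧ r ∉ X ∩ Y ∧ (cut r L (X ∩ Y)).ncard = k from
        ⟨⟨hvX, hvY⟩, fun h => hrX h.1, by omega⟩) Set.inter_subset_left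
    exact h4.trans Set.inter_subset_right
  have key : ∀ u, (u, v) ∈ L → (u, v) ∉ F → u ∉ X ∧ (u ≠ r → ∀ y ∈ X, (u, y) ∈ L → y = v) := by
    intro u hu huF
    have := hcrit (u, v) ⟨⟨hu, rfl⟩, huF⟩
    simp only [Conn] at this
    push Not at this
    obtain ⟨Y, hvY, hrY, hY⟩ := this
    have h1 := hL Y hvY hrY
    have h2 := cut_diff_le r L (u, v) Y
    obtain ⟨-, -, h3, h4⟩ := crit hrY (hY.trans_le h1)
    have h5 := hsub Y hvY hrY (by omega)
    exact ⟨fun h => h3 (h5 h), fun h y hy => h4 h y (h5 hy)⟩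
  have hinj : Set.InjOn (rep r) (inEdges L v \ F) := by
    rintro ⟨a, b⟩ ⟨⟨h1, h2⟩, h3⟩ ⟨a', b'⟩ ⟨⟨h1', h2'⟩, h3'⟩ h
    simp only at h2 h2'
    subst h2 h2'
    have k1 := key a h1 h3
    have k2 := key a' h1' h3'
    simp only [rep] at h
    grind
  have hdisj : Disjoint (cut r F X) (rep r '' (inEdges L v \ F)) := by
    rw [Set.disjoint_right]
    rintro _ ⟨⟨a, b⟩, ⟨⟨h1, h2⟩, h3⟩, rfl⟩ hx
    simp only at h2
    subst h2
    have := key a h1 h3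
    simp only [cut, rep, Set.mem_ofPred_eq] at hx
    grind
  have hsub2 : cut r F X ∪ rep r '' (inEdges L v \ F) ⊆ cut r L X := by
    apply Set.union_subset (cut_mono r hFL X)
    rintro _ ⟨⟨a, b⟩, ⟨⟨h1, h2⟩, h3⟩, rfl⟩
    simp only at h2
    subst h2
    have := key a h1 h3
    simp only [cut, rep, Set.mem_ofPred_eq]
    grind
  have h1 := Set.ncard_le_ncard hsub2 (Set.toFinite _)
  rw [Set.ncard_union_eq hdisj (Set.toFinite _) (Set.toFinite _)] at h1
  rw [Set.InjOn.ncard_image hinj] at h1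
  have h2 := hF X hvX hrX
  have h3 : inEdges L v ⊆ inEdges F v ∪ (inEdges L v \ F) := by
    intro e he
    by_cases h : e ∈ F
    · exact Or.inl ⟨h, he.2⟩
    · exact Or.inr ⟨he, h⟩
  have h4 := Set.ncard_le_ncard h3 (Set.toFinite _)
  have h5 := Set.ncard_union_le (inEdges F v) (inEdges L v \ F)
  omega

/-! ## Lists and paths -/

lemma exists_path (R : V → V → Prop) (a b : V) (h : Relation.ReflTransGen R a b) :
    ∃ l : List V, List.IsChain R (a :: l) ∧ (a :: l).Nodup ∧
      (a :: l).getLast (List.cons_ne_nil _ _) = b := by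
  induction h using Relation.ReflTransGen.head_induction_on with
  | refl => exact ⟨[], by simp⟩
  | head hac hcb ih =>
    rename_i a c
    obtain ⟨l, h1, h2, h3⟩ := ih
    by_cases ha : a ∈ c :: l
    · obtain ⟨s, t, hst⟩ := List.append_of_mem ha
      refine ⟨t, ?_, ?_, ?_⟩
      · rw [hst] at h1
        exact h1.right_of_append
      · rw [hst] at h2
        exact h2.of_append_right
      · rw [← h3]
        simp [hst]
    · exact ⟨c :: l, List.isChain_cons_cons.mpr ⟨hac, h1⟩, List.nodup_cons.mpr ⟨ha, h2⟩,
        by simpa using h3⟩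

lemma same_tail (L : Set (V × V)) (r v : V)
    (hout : ∀ a b c, a ≠ r → (a, b) ∈ L → (a, c) ∈ L → b = c) :
    ∀ (s s' : List V) (x : V), List.IsChain (fun a b => (a, b) ∈ L) (x :: s ++ [v]) →
      List.IsChain (fun a b => (a, b) ∈ L) (x :: s' ++ [v]) →
      v ∉ x :: s → v ∉ x :: s' → r ∉ x :: s →
      (x :: s).getLast (List.cons_ne_nil _ _) = (x :: s').getLast (List.cons_ne_nil _ _) := by
  intro s
  induction s with
  | nil =>
    intro s' x h1 h2 h3 h4 h5
    cases s' with
    | nil => rfl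
    | cons y t =>
      simp only [List.cons_append, List.nil_append, List.isChain_cons_cons] at h1 h2
      have := hout x v y (by grind) h1.1 h2.1
      grind
  | cons z s ih =>
    intro s' x h1 h2 h3 h4 h5
    cases s' with
    | nil =>
      simp only [List.cons_append, List.nil_append, List.isChain_cons_cons] at h1 h2
      have := hout x v z (by grind) h2.1 h1.1
      grind
    | cons y t =>
      simp only [List.cons_append, List.nil_append, List.isChain_cons_cons] at h1 h2
      have := hout x z y (by grind) h1.1 h2.1
      subst this
      have := ih t z h1.2 h2.2 (by grind) (by grind) (by grind)
      simpa using this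

lemma cross (R : V → V → Prop) (X : Set V) : ∀ (l : List V) (y : V), List.IsChain R (y :: l) →
    y ∉ X → (y :: l).getLast (List.cons_ne_nil _ _) ∈ X →
    ∃ c ∈ y :: l, c ∉ X ∧ ∃ b ∈ X, R c b := by
  intro l
  induction l with
  | nil => intro y _ h1 h2; exact absurd h2 h1
  | cons z l ih =>
    intro y h h1 h2
    rw [List.isChain_cons_cons] at h
    by_cases hz : z ∈ X
    · exact ⟨y, by simp, h1, z, hz, h.1⟩
    · obtain ⟨c, hc, h3⟩ := ih z h.2 hz (by simpa using h2)
      exact ⟨c, List.mem_cons_of_mem _ hc, h3⟩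

lemma zip_last (v : V) : ∀ (l : List V) (a : V), ((a :: (l ++ [v])).zip (l ++ [v])).getLast? =
    some ((a :: l).getLast (List.cons_ne_nil _ _), v) := by
  intro l
  induction l with
  | nil => intro a; simp
  | cons b l ih =>
    intro a
    have := ih b
    simp only [List.cons_append, List.zip_cons_cons] at this ⊢
    rw [List.getLast?_cons, this]
    simp

/-! ## Weak duality -/

instance finite_dipath [Finite V] (L : Set (V × V)) : Finite (Dipath L) := by
  have := Fintype.ofFinite V
  refine Finite.of_injective (fun p : Dipath L => (⟨p.start :: p.rest, p.nodup⟩ : {l : List V // l.Nodup})) ?_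
  rintro ⟨a, l, h1, h2⟩ ⟨a', l', h1', h2'⟩ h
  simp only [Subtype.mk.injEq, List.cons.injEq] at h
  obtain ⟨rfl, rfl⟩ := h
  rfl

lemma dipath_ext {L : Set (V × V)} {p q : Dipath L} (h1 : p.start = q.start)
    (h2 : p.rest = q.rest) : p = q := by
  cases p; cases q; simp_all

lemma path_cut {L : Set (V × V)} {r v : V} (hv : v ≠ r) (X : Set V) (hvX : v ∈ X) (hrX : r ∉ X)
    (p : Dipath L) (hs : p.start = r) (hl : p.last = v) :
    ∃ c ∈ p.support, c ∈ cut r L X ∧ c ≠ r ∧ (c = v → p.rest = [v]) := by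
  obtain ⟨a, l, h1, h2⟩ := p
  simp only [Dipath.last, Dipath.support, Dipath.verts] at *
  subst hs
  change List.IsChain _ _ at h1
  cases l with
  | nil => simp at hl; exact absurd hl.symm hv
  | cons y l =>
    rw [List.isChain_cons_cons] at h1
    have hl' : (y :: l).getLast (List.cons_ne_nil _ _) = v := by simpa using hl
    by_cases hy : y ∈ X
    · refine ⟨y, by simp, Or.inr ⟨hy, h1.1⟩, by grind, ?_⟩
      rintro rfl
      cases l with
      | nil => rfl
      | cons z l =>
        have : (z :: l).getLast (List.cons_ne_nil _ _) = y := by simpa using hl'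
        have := List.getLast_mem (List.cons_ne_nil z l)
        grind
    · obtain ⟨c, hc, hcX, b, hb, hcb⟩ := cross _ X l y h1.2 hy (by rwa [hl'])
      have hca : c ≠ a := by grind
      exact ⟨c, List.mem_cons_of_mem _ hc, Or.inl ⟨hcX, hca, b, hb, hcb⟩, hca,
        fun h => absurd (h ▸ hvX) hcX⟩

lemma weak [Finite V] {L : Set (V × V)} {r v : V} (hv : v ≠ r) {P : Set (Dipath L)}
    (hP : IsRVSystem L r v P) : Conn r L v P.ncard := by
  intro X hvX hrX
  have h : ∀ p : Dipath L, ∃ c, p ∈ P →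
      c ∈ p.support ∧ c ∈ cut r L X ∧ c ≠ r ∧ (c = v → p.rest = [v]) := by
    intro p
    by_cases hp : p ∈ P
    · obtain ⟨c, h⟩ := path_cut hv X hvX hrX p (hP.1 p hp).1 (hP.1 p hp).2
      exact ⟨c, fun _ => h⟩
    · exact ⟨r, fun h => absurd h hp⟩
  choose f hf using h
  refine Set.ncard_le_ncard_of_injOn f (fun p hp => (hf p hp).2.1) ?_ (Set.toFinite _)
  intro p hp q hq hpq
  by_contra hne
  have h1 := hP.2 hp hq hne ⟨(hf p hp).1, hpq ▸ (hf q hq).1⟩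
  obtain ⟨-, -, h2, h3⟩ := hf p hp
  obtain ⟨-, -, h4, h5⟩ := hf q hq
  rcases h1 with h1 | h1
  · exact h2 h1
  · have h1 : f p = v := h1
    exact hne (dipath_ext ((hP.1 p hp).1.trans (hP.1 q hq).1.symm)
      ((h3 h1).trans (h5 (hpq ▸ h1)).symm))

lemma path_lastEdge {L : Set (V × V)} {r v : V} (hv : v ≠ r)
    (p : Dipath L) (hs : p.start = r) (hl : p.last = v) :
    ∃ u, p.lastEdge? = some (u, v) ∧ (u, v) ∈ L ∧ u ∈ p.support ∧ u ≠ v ∧ (u = r → p.rest = [v]) := by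
  obtain ⟨a, l, h1, h2⟩ := p
  simp only [Dipath.last, Dipath.support, Dipath.verts, Dipath.lastEdge?, Dipath.edges] at *
  subst hs
  change List.IsChain _ _ at h1
  rcases List.eq_nil_or_concat' l with rfl | ⟨m, w, rfl⟩
  · simp at hl; exact absurd hl.symm hv
  · have : w = v := by simpa using hl
    subst this
    have hmem := List.getLast_mem (List.cons_ne_nil a m)
    refine ⟨_, zip_last w m a, ?_, ?_, ?_, ?_⟩
    · rw [← List.cons_append, List.isChain_append] at h1
      exact h1.2.2 _ (by rw [List.getLast?_eq_getLast_of_ne_nil (List.cons_ne_nil a m)]; simp) _ (by simp)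
    · show _ ∈ a :: (m ++ [w])
      grind
    · grind
    · intro h
      cases m with
      | nil => rfl
      | cons z m =>
        have h' : (z :: m).getLast (List.cons_ne_nil _ _) = a := by simpa using h
        have := List.getLast_mem (List.cons_ne_nil z m)
        grind

lemma termEdges_ncard [Finite V] {L : Set (V × V)} {r v : V} (hv : v ≠ r) {P : Set (Dipath L)}
    (hP : IsRVSystem L r v P) : termEdges P ⊆ inEdges L v ∧ (termEdges P).ncard = P.ncard := by
  have h : ∀ p : Dipath L, ∃ u, p ∈ P →
     p.lastEdge? = some (u, v) ∧ (u, v) ∈ L ∧ u ∈ p.support ∧ u ≠ v ∧ (u = r → p.rest = [v]) := by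
    intro p
    by_cases hp : p ∈ P
    · obtain ⟨c, h⟩ := path_lastEdge hv p (hP.1 p hp).1 (hP.1 p hp).2
      exact ⟨c, fun _ => h⟩
    · exact ⟨r, fun h => absurd h hp⟩
  choose f hf using h
  have heq : termEdges P = (fun p => (f p, v)) '' P := by
    ext e
    constructor
    · rintro ⟨p, hp, h⟩
      refine ⟨p, hp, ?_⟩
      have := (hf p hp).1
      rw [h] at this
      exact (Option.some.inj this).symm
    · rintro ⟨p, hp, rfl⟩
      exact ⟨p, hp, (hf p hp).1⟩
  constructor
  · rw [heq]
    rintro _ ⟨p, hp, rfl⟩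
    exact ⟨(hf p hp).2.1, rfl⟩
  · rw [heq]
    apply Set.InjOn.ncard_image
    intro p hp q hq hpq
    have hpq : f p = f q := (Prod.mk.inj hpq).1
    by_contra hne
    obtain ⟨-, -, h0, h2, h3⟩ := hf p hp
    obtain ⟨-, -, h0', h4, h5⟩ := hf q hq
    rcases hP.2 hp hq hne ⟨h0, hpq ▸ h0'⟩ with h1 | h1
    · have h1 : f p = r := h1
      exact hne (dipath_ext ((hP.1 p hp).1.trans (hP.1 q hq).1.symm)
        ((h3 h1).trans (h5 (hpq ▸ h1)).symm))
    · exact h2 h1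

/-! ## Menger's theorem -/

lemma menger [Finite V] {L : Set (V × V)} {r v : V} (hv : v ≠ r) {k : ℕ} (hL : Conn r L v k) :
    ∃ P : Set (Dipath L), IsRVSystem L r v P ∧ k ≤ P.ncard := by
  obtain ⟨M, ⟨hML, hMk⟩, hmin⟩ := exists_minimal_of_wellFoundedLT
    (fun M : Set (V × V) => M ⊆ L ∧ Conn r M v k) ⟨L, subset_rfl, hL⟩
  -- every edge of the minimal digraph is critical
  have hcrit : ∀ a b, (a, b) ∈ M → ∃ X : Set V, v ∈ X ∧ r ∉ X ∧ (cut r M X).ncard = k ∧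
      b ∈ X ∧ a ∉ X ∧ (a ≠ r → ∀ y ∈ X, (a, y) ∈ M → y = b) := by
    intro a b hab
    have hn : ¬ Conn r (M \ {(a, b)}) v k := by
      intro hc
      have hle : M ⊆ M \ {(a, b)} := hmin (y := M \ {(a, b)})
        (show M \ {(a, b)} ⊆ L ∧ Conn r (M \ {(a, b)}) v k from
          ⟨Set.sdiff_subset.trans hML, hc⟩) Set.sdiff_subset
      exact (hle hab).2 rfl
    simp only [Conn] at hn
    push Not at hn
    obtain ⟨X, hvX, hrX, hX⟩ := hn
    have h1 := hMk X hvX hrX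
    have h2 := cut_diff_le r M (a, b) X
    exact ⟨X, hvX, hrX, by omega, (crit hrX (hX.trans_le h1)).2⟩
  have hout : ∀ a b c, a ≠ r → (a, b) ∈ M → (a, c) ∈ M → b = c := by
    intro a b c har hab hac
    obtain ⟨X, hvX, hrX, hXk, hbX, haX, hX⟩ := hcrit a b hab
    obtain ⟨Y, hvY, hrY, hYk, hcY, haY, hY⟩ := hcrit a c hac
    by_contra hbc
    have h1 := cut_submod_lt r M X Y a (Or.inl ⟨haX, har, b, hbX, hab⟩)
      (Or.inl ⟨haY, har, c, hcY, hac⟩) (by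
        simp only [cut, Set.mem_inter_iff, Set.mem_ofPred_eq]
        grind)
    have h2 := hMk (X ∩ Y) ⟨hvX, hvY⟩ (fun h => hrX h.1)
    have h3 := hMk (X ∪ Y) (Or.inl hvX) (by rintro (h | h) <;> contradiction)
    omega
  have hreach : ∀ u, (u, v) ∈ M →
      Relation.ReflTransGen (fun a b => (a, b) ∈ M ∧ b ≠ v) r u := by
    intro u huv
    by_contra hu
    obtain ⟨X, hvX, hrX, hXk, -, huX, hX⟩ := hcrit u v huv
    set U : Set V := {x | ¬ Relation.ReflTransGen (fun a b => (a, b) ∈ M ∧ b ≠ v) r x} with hU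
    have hrU : r ∉ U := fun h => h Relation.ReflTransGen.refl
    have hur : u ≠ r := by rintro rfl; exact hu Relation.ReflTransGen.refl
    have hstep : ∀ x y, x ∉ U → (x, y) ∈ M → y ∈ U → y = v := by
      intro x y hx hxy hy
      by_contra hyv
      exact hy ((not_not.mp hx).tail ⟨hxy, hyv⟩)
    have huU : u ∈ U := hu
    have hlt : cut r M (X ∪ U) ⊂ cut r M X := by
      refine ⟨?_, fun h => ?_⟩
      · rintro x (⟨h1, h2, y, hy, h3⟩ | ⟨h1, h2⟩)
        · refine Or.inl ⟨fun h => h1 (Or.inl h), h2, y, ?_, h3⟩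
          rcases hy with hy | hy
          · exact hy
          · rwa [hstep x y (fun h => h1 (Or.inr h)) h3 hy]
        · refine Or.inr ⟨?_, h2⟩
          rcases h1 with h1 | h1
          · exact h1
          · rwa [hstep r x hrU h2 h1]
      · rcases h (Or.inl ⟨huX, hur, v, hvX, huv⟩) with ⟨h1, -⟩ | ⟨h1, h2⟩
        · exact h1 (Or.inr huU)
        · exact huX (hstep r u hrU h2 huU ▸ hvX)
    have h1 := Set.ncard_lt_ncard hlt (Set.toFinite _)
    have h2 := hMk (X ∪ U) (Or.inl hvX) (by rintro (h | h) <;> contradiction)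
    omega
  -- the paths
  have hpath : ∀ u : {u // (u, v) ∈ M}, ∃ m : List V,
      List.IsChain (fun a b => (a, b) ∈ M) (r :: m ++ [v]) ∧ (r :: m ++ [v]).Nodup ∧
      (r :: m).getLast (List.cons_ne_nil _ _) = u := by
    rintro ⟨u, hu⟩
    obtain ⟨m, h1, h2, h3⟩ := exists_path _ _ _ (hreach u hu)
    have hvm : v ∉ r :: m := by
      intro h
      rcases List.mem_cons.mp h with h | h
      · exact hv h
      · obtain ⟨s, t, rfl⟩ := List.append_of_mem h
        rw [← List.cons_append, List.isChain_append] at h1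
        exact (h1.2.2 ((r :: s).getLast (List.cons_ne_nil r s)) (by
          rw [List.getLast?_eq_getLast_of_ne_nil (List.cons_ne_nil r s)]; rfl) v (by simp)).2 rfl
    refine ⟨m, ?_, ?_, h3⟩
    · rw [List.isChain_append]
      refine ⟨h1.imp fun a b h => h.1, by simp, ?_⟩
      intro x hx y hy
      rw [List.getLast?_eq_getLast_of_ne_nil (List.cons_ne_nil r m), h3] at hx
      simp at hx hy
      subst hx hy
      exact hu
    · rw [List.nodup_append]
      exact ⟨h2, by simp, by grind⟩
  choose m hm1 hm2 hm3 using hpath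
  let f : {u // (u, v) ∈ M} → Dipath L := fun u =>
    ⟨r, m u ++ [v], (hm1 u).imp fun a b h => hML h, hm2 u⟩
  have hinj : Function.Injective f := by
    intro u u' h
    have h : m u ++ [v] = m u' ++ [v] := congrArg Dipath.rest h
    have h : m u = m u' := List.append_cancel_right h
    apply Subtype.ext
    rw [← hm3 u, ← hm3 u']
    simp [h]
  refine ⟨Set.range f, ⟨?_, ?_⟩, ?_⟩
  · rintro _ ⟨u, rfl⟩
    exact ⟨rfl, by simp [f, Dipath.last]⟩
  · rintro _ ⟨u, rfl⟩ _ ⟨u', rfl⟩ hne x ⟨hx, hx'⟩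
    by_contra hxrv
    simp only [Set.mem_insert_iff, Set.mem_singleton_iff, not_or] at hxrv
    apply hne
    congr 1
    have h1 : x ∈ m u := by
      have : x ∈ r :: (m u ++ [v]) := hx
      grind
    have h2 : x ∈ m u' := by
      have : x ∈ r :: (m u' ++ [v]) := hx'
      grind
    obtain ⟨s, t, hst⟩ := List.append_of_mem h1
    obtain ⟨s', t', hst'⟩ := List.append_of_mem h2
    have a1 := hm1 u
    have a1' := hm1 u'
    have a2 := hm2 u
    have a2' := hm2 u'
    have a3 := hm3 u
    have a3' := hm3 u'
    rw [hst] at a1 a2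
    rw [hst'] at a1' a2'
    simp only [hst] at a3
    simp only [hst'] at a3'
    have key := same_tail M r v hout t t' x
      (List.IsChain.right_of_append (l₁ := r :: s) (by simpa using a1))
      (List.IsChain.right_of_append (l₁ := r :: s') (by simpa using a1'))
      (by grind) (by grind) (by grind)
    apply Subtype.ext
    rw [← a3, ← a3']
    simpa using key
  · rw [Set.ncard_range_of_injective hinj]
    have h1 := hMk {v} rfl (fun h => hv h.symm)
    refine h1.trans ?_
    classical
    have hsub : cut r M {v} ⊆ (fun u => if u = r then v else u) '' {u | (u, v) ∈ M} := by
      rintro x (⟨h1, h2, y, hy, h3⟩ | ⟨h1, h2⟩)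
      · have hy : y = v := hy
        subst hy
        exact ⟨x, h3, by simp [h2]⟩
      · have h1 : x = v := h1
        subst h1
        exact ⟨r, h2, by simp⟩
    exact (Set.ncard_le_ncard hsub (Set.toFinite _)).trans (Set.ncard_image_le (Set.toFinite _))

/-! ## The local connectivity -/

lemma kappa_attained [Finite V] {L : Set (V × V)} {r v : V} (hv : v ≠ r) :
    BddAbove {n | ∃ P : Set (Dipath L), IsRVSystem L r v P ∧ P.Finite ∧ P.ncard = n} ∧
    ∃ P : Set (Dipath L), IsRVSystem L r v P ∧ P.ncard = kappa L r v := by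
  have hb : BddAbove {n | ∃ P : Set (Dipath L), IsRVSystem L r v P ∧ P.Finite ∧ P.ncard = n} := by
    refine ⟨(cut r L {v}).ncard, ?_⟩
    rintro n ⟨P, hP, -, rfl⟩
    exact weak hv hP {v} rfl (fun h => hv h.symm)
  refine ⟨hb, ?_⟩
  have hne : {n | ∃ P : Set (Dipath L), IsRVSystem L r v P ∧ P.Finite ∧ P.ncard = n}.Nonempty :=
    ⟨0, ∅, ⟨by simp, by simp⟩, by simp, by simp⟩
  obtain ⟨P, h1, -, h2⟩ := Nat.sSup_mem hne hb
  exact ⟨P, h1, h2⟩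

lemma le_kappa_iff [Finite V] {L : Set (V × V)} {r v : V} (hv : v ≠ r) (k : ℕ) :
    k ≤ kappa L r v ↔ Conn r L v k := by
  obtain ⟨hb, P, hP, hPk⟩ := kappa_attained (L := L) hv
  constructor
  · intro h X hvX hrX
    have := weak hv hP X hvX hrX
    omega
  · intro h
    obtain ⟨Q, hQ, hk⟩ := menger hv h
    exact hk.trans (le_csSup hb ⟨Q, hQ, Set.toFinite _, rfl⟩)

lemma exists_tight [Finite V] {L : Set (V × V)} {r v : V} (hv : v ≠ r) :
    ∃ X : Set V, v ∈ X ∧ r ∉ X ∧ (cut r L X).ncard = kappa L r v := by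
  by_contra hc
  push Not at hc
  have h1 : Conn r L v (kappa L r v) := (le_kappa_iff hv _).1 le_rfl
  have h2 : Conn r L v (kappa L r v + 1) := fun X hvX hrX =>
    lt_of_le_of_ne (h1 X hvX hrX) (Ne.symm (hc X hvX hrX))
  have := (le_kappa_iff hv _).2 h2
  omega

end FlameAux

open FlameAux in
/-- **Calvillo-Vives' theorem.** In a finite rooted digraph every vertex-flame can be
extended to a vertex-flame preserving the local connectivities from the root. -/
theorem stmt1 {V : Type u} [Fintype V] (E : Set (V × V)) (r : V)
    (F : Set (V × V)) (hFE : F ⊆ E) (hF : IsFlame F r) :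
    ∃ Fstar : Set (V × V), F ⊆ Fstar ∧ Fstar ⊆ E ∧ IsFlame Fstar r ∧
      ∀ v, v ≠ r → kappa Fstar r v = kappa E r v := by
  obtain ⟨L, ⟨hFL, hLE, hLk⟩, hmin⟩ := exists_minimal_of_wellFoundedLT
    (fun L : Set (V × V) => F ⊆ L ∧ L ⊆ E ∧ ∀ v, v ≠ r → kappa L r v = kappa E r v)
    ⟨E, hFE, subset_rfl, fun _ _ => rfl⟩
  refine ⟨L, hFL, hLE, ?_, hLk⟩
  intro v hv
  have hLv : Conn r L v (kappa L r v) := (le_kappa_iff hv _).1 le_rfl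
  obtain ⟨X, hvX, hrX, hX⟩ := exists_tight (L := L) hv
  have hFc : Conn r F v (inEdges F v).ncard := by
    obtain ⟨P, hP, hPe⟩ := hF v hv
    rw [← hPe, (termEdges_ncard hv hP).2]
    exact weak hv hP
  have hcrit : ∀ e ∈ inEdges L v \ F, ¬ Conn r (L \ {e}) v (kappa L r v) := by
    rintro ⟨u, w⟩ ⟨⟨he, hw⟩, heF⟩ hc
    simp only at hw
    subst hw
    have hle : L ⊆ L \ {(u, w)} := hmin (y := L \ {(u, w)}) (show F ⊆ L \ {(u, w)} ∧
        L \ {(u, w)} ⊆ E ∧ ∀ v, v ≠ r → kappa (L \ {(u, w)}) r v = kappa E r v from by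
      refine ⟨fun f hf => ⟨hFL hf, fun h => heF (h ▸ hf)⟩, Set.sdiff_subset.trans hLE, ?_⟩
      intro x hx
      rw [← hLk x hx]
      apply le_antisymm
      · exact (le_kappa_iff hx _).2 (((le_kappa_iff hx _).1 le_rfl).mono Set.sdiff_subset)
      · exact (le_kappa_iff hx _).2
          (Conn.delete X hvX hrX hX hc ((le_kappa_iff hx _).1 le_rfl))) Set.sdiff_subset
    exact (hle he).2 rfl
  have hdeg := indeg_le hFL hLv X hvX hrX hX hFc hcrit
  obtain ⟨-, P, hP, hPk⟩ := kappa_attained (L := L) hv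
  obtain ⟨h1, h2⟩ := termEdges_ncard hv hP
  exact ⟨P, hP, Set.eq_of_subset_of_ncard_le h1 (by omega) (Set.toFinite _)⟩
end

section
/- Let D be a digraph and X, Y sets of vertices such that vertices of X have no ingoing edges and vertices of Y have no outgoing edges. Let x ∈ X, and suppose X−x is joinable to Y in D but X is not joinable to Y in D. Then there exists an Erdős–Menger (X,Y)-separation S such that X−x is incompressible to S in D. -/
/-!  Common framework: digraphs as edge sets on a vertex type, directed paths,
path-systems, separations, flames and largeness. -/

universe u

variable {V : Type u}

section Aux

/-- Reachability inside a vertex set. -/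
def Reach {W : Type*} (E : Set (W × W)) (C : Set W) (a b : W) : Prop :=
  a ∈ C ∧ Relation.ReflTransGen (fun u v => (u, v) ∈ E ∧ v ∈ C) a b

/-- Separation in terms of reachability. -/
def VSep {W : Type*} (E : Set (W × W)) (A B S : Set W) : Prop :=
  ∀ a ∈ A, ∀ b ∈ B, ¬ Reach E Sᶜ a b

variable {W : Type*} {E : Set (W × W)} {C D : Set W} {a b c : W}

theorem Reach.mem_left (h : Reach E C a b) : a ∈ C := h.1

theorem Reach.mem_right (h : Reach E C a b) : b ∈ C := by
  obtain ⟨h1, h2⟩ := h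
  induction h2 with
  | refl => exact h1
  | tail _ h _ => exact h.2

theorem Reach.refl (h : a ∈ C) : Reach E C a a := ⟨h, .refl⟩

theorem Reach.trans (h : Reach E C a b) (h' : Reach E C b c) : Reach E C a c :=
  ⟨h.1, h.2.trans h'.2⟩

theorem Reach.tail (h : Reach E C a b) (h' : (b, c) ∈ E) (hc : c ∈ C) : Reach E C a c :=
  ⟨h.1, h.2.tail ⟨h', hc⟩⟩

theorem Reach.mono (h : Reach E C a b) (hCD : C ⊆ D) : Reach E D a b :=
  ⟨hCD h.1, h.2.lift id fun _ _ h => ⟨h.1, hCD h.2⟩⟩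

theorem Reach.monoE {F : Set (W × W)} (h : Reach E C a b) (hCD : E ⊆ F) : Reach F C a b :=
  ⟨h.1, h.2.lift id fun _ _ h => ⟨hCD h.1, h.2⟩⟩

theorem Reach.ind {P : W → Prop} (h : Reach E C a b) (h0 : a ∈ C → P a)
    (hs : ∀ u v, Reach E C a u → (u, v) ∈ E → v ∈ C → P u → P v) : P b := by
  obtain ⟨h1, h2⟩ := h
  induction h2 with
  | refl => exact h0 h1
  | tail h h' ih => exact hs _ _ ⟨h1, h⟩ (And.left h') (And.right h') ih

/-- restricting to the reachable set -/
theorem Reach.restrict (h : Reach E C a b) :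
    Reach E {w | Reach E C a w} a b := by
  refine h.ind (fun h => .refl (.refl h)) fun u v hu he hv ih => ih.tail he (hu.tail he hv)

theorem Reach.finite (h : Reach E C a b) :
    ∃ F : Finset W, (F : Set W) ⊆ C ∧ Reach E (F : Set W) a b := by
  classical
  refine h.ind (P := fun b => ∃ F : Finset W, (F : Set W) ⊆ C ∧ Reach E (F : Set W) a b)
    (fun h => ⟨{a}, by simpa, .refl (by simp)⟩) fun u v hu he hv ih => ?_
  obtain ⟨F, hF, hR⟩ := ih
  refine ⟨insert v F, by simp [Set.insert_subset_iff, hv, hF], ?_⟩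
  exact (hR.mono (by simp)).tail he (by simp)

/-- Cut at the first hit of `Z`. -/
theorem Reach.cut {Z : Set W} (h : Reach E C a b) (hZ : b ∈ Z) :
    ∃ z ∈ Z, ∃ C' ⊆ C, Reach E C' a z ∧ ∀ w ∈ C', w ≠ z → Reach E (C ∩ Zᶜ) a w := by
  have key : (∃ z ∈ Z, ∃ C' ⊆ C, Reach E C' a z ∧ ∀ w ∈ C', w ≠ z → Reach E (C ∩ Zᶜ) a w) ∨
      Reach E (C ∩ Zᶜ) a b := by
    refine h.ind (P := fun b => (∃ z ∈ Z, ∃ C' ⊆ C, Reach E C' a z ∧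
      ∀ w ∈ C', w ≠ z → Reach E (C ∩ Zᶜ) a w) ∨ Reach E (C ∩ Zᶜ) a b) ?_ ?_
    · intro ha
      by_cases hz : a ∈ Z
      · left
        refine ⟨a, hz, {a}, by simpa, .refl rfl, by simp⟩
      · right; exact .refl ⟨ha, hz⟩
    · intro u v hu he hv ih
      rcases ih with ih | ih
      · exact .inl ih
      by_cases hz : v ∈ Z
      · left
        refine ⟨v, hz, insert v {w | Reach E (C ∩ Zᶜ) a w}, ?_, ?_, ?_⟩
        · rintro w (rfl | hw)
          · exact hv
          · exact hw.mem_right.1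
        · exact (ih.restrict.mono (Set.subset_insert _ _)).tail he (Set.mem_insert _ _)
        · rintro w (rfl | hw) hne
          · exact absurd rfl hne
          · exact hw
      · exact .inr (ih.tail he ⟨hv, hz⟩)
  rcases key with h | h
  · exact h
  · exact absurd hZ h.mem_right.2

/-- reverse digraph -/
theorem Reach.rev (h : Reach E C a b) : Reach (Prod.swap ⁻¹' E) C b a := by
  have : Reach (Prod.swap ⁻¹' E) C b a := by
    refine h.ind (P := fun b => Reach (Prod.swap ⁻¹' E) C b a) (fun h => .refl h) ?_
    intro u v hu he hv ih
    exact ((Reach.refl hv).tail (show (v, u) ∈ Prod.swap ⁻¹' E from he) hu.mem_right).trans ih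
  exact this

theorem Reach.cut_last {Z : Set W} (h : Reach E C a b) (hZ : a ∈ Z) :
    ∃ z ∈ Z, ∃ C' ⊆ C, Reach E C' z b ∧ ∀ w ∈ C', w ≠ z → Reach E (C ∩ Zᶜ) w b := by
  obtain ⟨z, hz, C', hC, h1, h2⟩ := h.rev.cut hZ
  exact ⟨z, hz, C', hC, h1.rev, fun w hw hne => (h2 w hw hne).rev⟩

/-- `k` disjoint connections. -/
def Conn {W : Type*} (E : Set (W × W)) (A B : Set W) (k : ℕ) : Prop :=
  ∃ f : Fin k → Set W, Pairwise (fun i j => Disjoint (f i) (f j)) ∧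
    ∀ i, ∃ a ∈ A, ∃ b ∈ B, Reach E (f i) a b

theorem menger_aux (n : ℕ) : ∀ (E : Finset (W × W)) (_ : E.card = n) (A B : Set W) (k : ℕ)
    (_ : ∀ S : Finset W, S.card < k → ¬ VSep (E : Set (W × W)) A B S), Conn (E : Set (W × W)) A B k := by
  classical
  induction n with
  | zero =>
    intro E hE A B k h
    rw [Finset.card_eq_zero] at hE
    subst hE
    have : (k : ℕ∞) ≤ (A ∩ B).encard := by
      by_contra hlt
      push Not at hlt
      have hfin : (A ∩ B).Finite := Set.encard_lt_top_iff.1 (hlt.trans (ENat.natCast_lt_top k))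
      refine h hfin.toFinset ?_ ?_
      · rw [hfin.encard_eq_coe_toFinset_card] at hlt
        exact_mod_cast hlt
      · intro a ha b hb hR
        have : b = a := by
          refine hR.ind (P := fun b => b = a) (fun _ => rfl) ?_
          intro u v _ he
          simp at he
        subst this
        exact hR.1 (by simp [ha, hb])
    obtain ⟨t, ht, hc⟩ := Set.exists_subset_encard_eq this
    have hfin : t.Finite := Set.finite_of_encard_eq_coe hc
    have e : Fin k ≃ hfin.toFinset := (Fintype.equivFinOfCardEq (by
      rw [hfin.encard_eq_coe_toFinset_card] at hc
      simpa using (by exact_mod_cast hc : hfin.toFinset.card = k))).symm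
    refine ⟨fun i => {(e i : W)}, ?_, ?_⟩
    · intro i j hij
      simp only [Set.disjoint_singleton]
      exact fun h => hij (e.injective (Subtype.ext h))
    · intro i
      have hm : (e i : W) ∈ t := hfin.mem_toFinset.1 (e i).2
      exact ⟨e i, (ht hm).1, e i, (ht hm).2, .refl rfl⟩
  | succ n ih =>
    intro E hE A B k h
    obtain ⟨⟨u, v⟩, he⟩ : E.Nonempty := by rw [← Finset.card_pos]; omega
    set E' := E.erase (u, v) with hE'
    have hcE' : E'.card = n := by rw [hE', Finset.card_erase_of_mem he]; omega
    have hsub : (E' : Set (W × W)) ⊆ E := by exact_mod_cast Finset.erase_subset _ _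
    have hEe : ∀ {c d}, (c, d) ∈ (E : Set (W × W)) → (c, d) ∈ (E' : Set (W × W)) ∨ (c = u ∧ d = v) := by
      intro c d hcd
      by_cases h' : (c, d) = (u, v)
      · right; simpa using h'
      · left; exact_mod_cast Finset.mem_erase.2 ⟨h', by exact_mod_cast hcd⟩
    by_cases hall : ∀ S : Finset W, S.card < k → ¬ VSep (E' : Set (W × W)) A B S
    · obtain ⟨f, hf, hr⟩ := ih E' hcE' A B k hall
      refine ⟨f, hf, fun i => ?_⟩
      obtain ⟨a, ha, b, hb, hR⟩ := hr i
      exact ⟨a, ha, b, hb, hR.monoE hsub⟩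
    push Not at hall
    obtain ⟨S, hSk, hS⟩ := hall
    -- both enlarged sets separate
    have hSu : ∀ T : Finset W, VSep (E' : Set (W × W)) A (insert u (S : Set W)) T →
        VSep (E : Set (W × W)) A B T := by
      intro T hT a ha b hb hR
      have : Reach (E' : Set (W × W)) (insert u (S : Set W) ∪ T : Set W)ᶜ a b := by
        refine hR.ind (P := fun b => Reach (E' : Set (W × W)) (insert u (S : Set W) ∪ T : Set W)ᶜ a b) ?_ ?_
        · intro haT
          refine .refl ?_
          rintro (h' | h')
          · exact hT a ha a h' (.refl haT)
          · exact haT h'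
        · intro c d hc hcd hd ih
          rcases hEe hcd with h1 | ⟨rfl, rfl⟩
          · refine ih.tail h1 ?_
            rintro (h' | h')
            · exact hT a ha d h' ((ih.mono (by
                intro w hw hw'; exact hw (.inr hw'))).tail h1 hd)
            · exact hd h'
          · exact absurd (Set.mem_union_left _ (Set.mem_insert _ _)) ih.mem_right
      exact hS a ha b hb (this.mono (by
        intro w hw hw'; exact hw (.inl (.inr hw'))))
    have hSv : ∀ T : Finset W, VSep (E' : Set (W × W)) (insert v (S : Set W)) B T →
        VSep (E : Set (W × W)) A B T := by
      intro T hT a ha b hb hR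
      have : (∃ z ∈ insert v (S : Set W), Reach (E' : Set (W × W)) (T : Set W)ᶜ z b) ∨
          Reach (E' : Set (W × W)) ((S ∪ T : Set W))ᶜ a b := by
        refine hR.ind (P := fun b => (∃ z ∈ insert v (S : Set W), Reach (E' : Set (W × W)) (T : Set W)ᶜ z b) ∨
          Reach (E' : Set (W × W)) ((S ∪ T : Set W))ᶜ a b) ?_ ?_
        · intro haT
          by_cases haS : a ∈ S
          · exact .inl ⟨a, .inr haS, .refl haT⟩
          · right
            refine .refl ?_
            rintro (h' | h')
            exacts [haS h', haT h']
        · intro c d hc hcd hd ih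
          rcases hEe hcd with h1 | ⟨rfl, rfl⟩
          · rcases ih with ⟨z, hz, ih⟩ | ih
            · exact .inl ⟨z, hz, ih.tail h1 hd⟩
            · by_cases hdS : d ∈ S
              · exact .inl ⟨d, .inr hdS, .refl hd⟩
              · right
                refine ih.tail h1 ?_
                rintro (h' | h')
                exacts [hdS h', hd h']
          · exact .inl ⟨d, .inl rfl, .refl hd⟩
      rcases this with ⟨z, hz, h'⟩ | h'
      · exact hT z hz b hb h'
      · exact hS a ha b hb (h'.mono (by intro w hw hw'; exact hw (.inl hw')))
    obtain ⟨f, hf, hfr⟩ := ih E' hcE' A (insert u (S : Set W)) k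
      fun T hT hs => h T hT (hSu T hs)
    obtain ⟨g, hg, hgr⟩ := ih E' hcE' (insert v (S : Set W)) B k
      fun T hT hs => h T hT (hSv T hs)
    choose fa hfa fb hfb hfR using hfr
    choose ga hga gb hgb hgR using hgr
    have hcut1 := fun i => (hfR i).cut (hfb i)
    have hcut2 := fun i => (hgR i).cut_last (hga i)
    choose z hz F hFf hFR hFw using hcut1
    choose y hy G hGg hGR hGw using hcut2
    have hzinj : Function.Injective z := by
      intro i j hij
      by_contra hne
      exact Set.disjoint_left.1 (hf hne) (hFf _ (hFR i).mem_right)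
        (hij ▸ hFf _ (hFR j).mem_right)
    have hyinj : Function.Injective y := by
      intro i j hij
      by_contra hne
      exact Set.disjoint_left.1 (hg hne) (hGg _ (hGR i).mem_left)
        (hij ▸ hGg _ (hGR j).mem_left)
    have cardaux : ∀ (t : W) (w : Fin k → W), Function.Injective w → (∀ i, w i ∈ insert t (S : Set W)) →
        t ∉ S ∧ ∀ s ∈ insert t (S : Set W), ∃ i, w i = s := by
      intro t w hw hm
      have hsub : Finset.univ.image w ⊆ insert t S := by
        intro s hs
        simp only [Finset.mem_image, Finset.mem_univ, true_and] at hs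
        obtain ⟨i, rfl⟩ := hs
        simpa using hm i
      have hc : (Finset.univ.image w).card = k := by
        rw [Finset.card_image_of_injective _ hw]; simp
      have h1 := Finset.card_le_card hsub
      have h2 := Finset.card_insert_le t S
      constructor
      · intro ht
        rw [Finset.insert_eq_of_mem ht] at h1
        omega
      · intro s hs
        have heq := Finset.eq_of_subset_of_card_le hsub (by omega)
        have : s ∈ Finset.univ.image w := by rw [heq]; simpa using hs
        simpa using this
    obtain ⟨huS, hzs⟩ := cardaux u z hzinj hz
    obtain ⟨hvS, hys⟩ := cardaux v y hyinj hy
    -- the matching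
    have hσ : ∀ i, ∃ j, (z i = u ∧ y j = v) ∨ (z i ∈ S ∧ y j = z i) := by
      intro i
      rcases hz i with h' | h'
      · obtain ⟨j, hj⟩ := hys v (.inl rfl)
        exact ⟨j, .inl ⟨h', hj⟩⟩
      · obtain ⟨j, hj⟩ := hys (z i) (.inr h')
        exact ⟨j, .inr ⟨h', hj⟩⟩
    choose σ hσ using hσ
    -- location of the pieces
    have hFloc : ∀ i, ∀ w ∈ F i, w ∉ S → ∃ a ∈ A, Reach (E' : Set (W × W)) (S : Set W)ᶜ a w := by
      intro i w hw hwS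
      refine ⟨fa i, hfa i, ?_⟩
      by_cases hwz : w = z i
      · subst hwz
        have hR := (hFR i).restrict
        have := (hFR i).mono (D := (S : Set W)ᶜ) (by
          intro w hw hwS'
          by_cases h' : w = z i
          · exact hwS (h' ▸ hwS')
          · exact (hFw i w hw h').mem_right.2 (.inr hwS'))
        exact this
      · exact (hFw i w hw hwz).mono (by
          intro w hw hwS'
          exact hw.2 (.inr hwS'))
    have hGloc : ∀ i, ∀ w ∈ G i, w ∉ S → ∃ b ∈ B, Reach (E' : Set (W × W)) (S : Set W)ᶜ w b := by
      intro i w hw hwS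
      refine ⟨gb i, hgb i, ?_⟩
      by_cases hwz : w = y i
      · subst hwz
        have := (hGR i).mono (D := (S : Set W)ᶜ) (by
          intro w hw hwS'
          by_cases h' : w = y i
          · exact hwS (h' ▸ hwS')
          · exact (hGw i w hw h').mem_left.2 (.inr hwS'))
        exact this
      · exact (hGw i w hw hwz).mono (by
          intro w hw hwS'
          exact hw.2 (.inr hwS'))
    have hFS : ∀ i, ∀ w ∈ F i, w ∈ S → w = z i := by
      intro i w hw hwS
      by_contra hne
      exact (hFw i w hw hne).mem_right.2 (.inr hwS)
    have hGS : ∀ i, ∀ w ∈ G i, w ∈ S → w = y i := by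
      intro i w hw hwS
      by_contra hne
      exact (hGw i w hw hne).mem_left.2 (.inr hwS)
    have hσinj : Function.Injective σ := by
      intro i j hij
      apply hzinj
      rcases hσ i with ⟨h1, h2⟩ | ⟨h1, h2⟩ <;> rcases hσ j with ⟨h3, h4⟩ | ⟨h3, h4⟩
      · rw [h1, h3]
      · rw [← hij, h2] at h4; exact absurd (h4 ▸ h3) hvS
      · rw [hij, h4] at h2; exact absurd (h2 ▸ h1) hvS
      · rw [← h2, ← h4, hij]
    have hFG : ∀ i j, i ≠ j → Disjoint (F i) (G (σ j)) := by
      intro i j hij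
      rw [Set.disjoint_left]
      intro w hw hw'
      by_cases hwS : w ∈ S
      · have h1 := hFS i w hw hwS
        have h2 := hGS _ w hw' hwS
        rcases hσ j with ⟨h3, h4⟩ | ⟨h3, h4⟩
        · rw [h2, h4] at hwS; exact hvS hwS
        · rw [h4] at h2
          exact hij (hzinj (h1.symm.trans h2))
      · obtain ⟨a, ha, h1⟩ := hFloc i w hw hwS
        obtain ⟨b, hb, h2⟩ := hGloc _ w hw' hwS
        exact hS a ha b hb (h1.trans h2)
    refine ⟨fun i => F i ∪ G (σ i), ?_, ?_⟩
    · intro i j hij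
      rw [Set.disjoint_union_left, Set.disjoint_union_right, Set.disjoint_union_right]
      exact ⟨⟨(hf hij).mono (hFf i) (hFf j), hFG i j hij⟩, (hFG j i hij.symm).symm,
        (hg (hσinj.ne hij)).mono (hGg _) (hGg _)⟩
    · intro i
      refine ⟨fa i, hfa i, gb (σ i), hgb _, ?_⟩
      have h1 := ((hFR i).monoE hsub).mono (Set.subset_union_left (t := G (σ i)))
      have h2 := ((hGR (σ i)).monoE hsub).mono (Set.subset_union_right (s := F i))
      rcases hσ i with ⟨h3, h4⟩ | ⟨h3, h4⟩
      · refine (h1.tail (c := y (σ i)) ?_ h2.mem_left).trans h2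
        rw [h3, h4]; exact_mod_cast he
      · rw [h4] at h2
        exact h1.trans h2

/-- A disjoint path system indexed by its set `X` of initial vertices. -/
structure PSys {W : Type*} (E : Set (W × W)) (X Y : Set W) (p : W → ℕ → W) (n : W → ℕ) : Prop where
  zero : ∀ a ∈ X, p a 0 = a
  edge : ∀ a ∈ X, ∀ i < n a, (p a i, p a (i + 1)) ∈ E
  last : ∀ a ∈ X, p a (n a) ∈ Y
  inj : ∀ a ∈ X, ∀ b ∈ X, ∀ i ≤ n a, ∀ j ≤ n b, p a i = p b j → a = b ∧ i = j

/-- The transversal chosen by `τ`. -/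
def Tr {W : Type*} (X : Set W) (p : W → ℕ → W) (τ : W → ℕ) : Set W := {w | ∃ a ∈ X, p a (τ a) = w}

/-- Weak joinability. -/
def WJ {W : Type*} (E : Set (W × W)) (X Y : Set W) : Prop :=
  ∃ f : W → Set W, (∀ a ∈ X, ∃ b ∈ Y, Reach E (f a) a b) ∧
    ∀ a ∈ X, ∀ b ∈ X, a ≠ b → Disjoint (f a) (f b)

variable {X Y : Set W} {p : W → ℕ → W} {n : W → ℕ}

theorem PSys.seg (h : PSys E X Y p n) (ha : a ∈ X) {i j : ℕ} (hij : i ≤ j) (hj : j ≤ n a)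
    (hC : ∀ k, i ≤ k → k ≤ j → p a k ∈ C) : Reach E C (p a i) (p a j) := by
  induction j, hij using Nat.le_induction with
  | base => exact .refl (hC i le_rfl le_rfl)
  | succ j hij ih =>
    exact (ih (by omega) fun k h1 h2 => hC k h1 (by omega)).tail (h.edge a ha j (by omega))
      (hC _ (by omega) le_rfl)

theorem bb {x : W} (hx : x ∉ X) (h : PSys E X Y p n) (hn : ¬ WJ E (insert x X) Y) :
    ∃ τ : W → ℕ, (∀ a, τ a ≤ n a) ∧ VSep E (insert x X) Y (Tr X p τ) := by
  classical
  let ι := {F : Finset W // ∃ a ∈ insert x X, ∃ b ∈ Y, Reach E (F : Set W) a b}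
  let Ω := ∀ a : W, Fin (n a + 1)
  let K : ι → Set Ω := fun F => {τ | ∃ u ∈ F.1, u ∈ Tr X p fun a => (τ a : ℕ)}
  suffices hne : (⋂ i, K i).Nonempty by
    obtain ⟨τ, hτ⟩ := hne
    rw [Set.mem_iInter] at hτ
    refine ⟨fun a => τ a, fun a => Nat.lt_succ_iff.1 (τ a).2, ?_⟩
    intro a ha b hb hR
    obtain ⟨F, hF, hR'⟩ := hR.finite
    obtain ⟨u, hu, hu'⟩ := hτ ⟨F, a, ha, b, hb, hR'⟩
    exact hF hu hu'
  apply CompactSpace.iInter_nonempty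
  · rintro ⟨F, hF⟩
    have : K ⟨F, hF⟩ = ⋃ u ∈ F, {τ : Ω | u ∈ Tr X p fun a => (τ a : ℕ)} := by
      ext τ; simp [K]
    rw [this]
    refine F.finite_toSet.isClosed_biUnion fun u _ => ?_
    by_cases hu : ∃ a ∈ X, ∃ i ≤ n a, p a i = u
    · obtain ⟨a, ha, i, hi, rfl⟩ := hu
      have : {τ : Ω | p a i ∈ Tr X p fun a => (τ a : ℕ)} = (fun τ : Ω => τ a) ⁻¹' {j | (j : ℕ) = i} := by
        ext τ
        simp only [Tr, Set.mem_ofPred_eq, Set.mem_preimage]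
        constructor
        · rintro ⟨b, hb, heq⟩
          obtain ⟨rfl, h2⟩ := h.inj b hb a ha _ (Nat.lt_succ_iff.1 (τ b).2) i hi heq
          exact h2
        · intro heq
          exact ⟨a, ha, by rw [heq]⟩
      rw [this]
      exact (isClosed_discrete _).preimage (continuous_apply a)
    · have : {τ : Ω | u ∈ Tr X p fun a => (τ a : ℕ)} = ∅ := by
        ext τ
        simp only [Tr, Set.mem_ofPred_eq, Set.mem_empty_iff_false, iff_false]
        rintro ⟨a, ha, heq⟩
        exact hu ⟨a, ha, _, Nat.lt_succ_iff.1 (τ a).2, heq⟩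
      rw [this]; exact isClosed_empty
  · intro s
    -- finite sub-situation
    let U : Finset W := s.biUnion fun F => F.1
    let sp : W → Finset W := fun a => (Finset.range (n a + 1)).image (p a)
    have hsp : ∀ a w, w ∈ sp a ↔ ∃ i ≤ n a, p a i = w := by
      intro a w; simp [sp]
    have hXfin : {a ∈ X | ∃ u ∈ U, u ∈ sp a}.Finite := by
      have hsub : {a ∈ X | ∃ u ∈ U, u ∈ sp a} ⊆ ⋃ u ∈ U, {a ∈ X | u ∈ sp a} := by
        rintro a ⟨ha, u, hu, hu'⟩
        simp only [Set.mem_iUnion]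
        exact ⟨u, hu, ha, hu'⟩
      refine Set.Finite.subset (U.finite_toSet.biUnion fun u _ => ?_) hsub
      apply Set.Subsingleton.finite
      rintro a ⟨ha, h1⟩ b ⟨hb, h2⟩
      rw [hsp] at h1 h2
      obtain ⟨i, hi, h1⟩ := h1
      obtain ⟨j, hj, h2⟩ := h2
      exact (h.inj a ha b hb i hi j hj (h1.trans h2.symm)).1
    -- the finite set of relevant initial vertices; also the one whose path contains `x`
    have hXfin2 : {a ∈ X | x ∈ sp a}.Finite := by
      apply Set.Subsingleton.finite
      rintro a ⟨ha, h1⟩ b ⟨hb, h2⟩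
      rw [hsp] at h1 h2
      obtain ⟨i, hi, h1⟩ := h1
      obtain ⟨j, hj, h2⟩ := h2
      exact (h.inj a ha b hb i hi j hj (h1.trans h2.symm)).1
    let H : Finset W := hXfin.toFinset ∪ hXfin2.toFinset
    have hHX : ∀ a ∈ H, a ∈ X := by
      intro a ha
      simp only [H, Finset.mem_union, Set.Finite.mem_toFinset, Set.mem_ofPred_eq] at ha
      rcases ha with ha | ha <;> exact ha.1
    have hxH : x ∉ H := fun h' => hx (hHX x h')
    let VH : Finset W := insert x (U ∪ H.biUnion sp)
    have hVH : ∀ a ∈ X, a ∉ H → ∀ w ∈ sp a, w ∉ VH := by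
      intro a ha haH w hw hwV
      simp only [H, Finset.mem_union, Set.Finite.mem_toFinset, Set.mem_ofPred_eq] at haH
      push Not at haH
      simp only [VH, Finset.mem_insert, Finset.mem_union, Finset.mem_biUnion] at hwV
      rcases hwV with rfl | hwV | ⟨b, hb, hwb⟩
      · exact haH.2 ha hw
      · exact haH.1 ha w hwV hw
      · rw [hsp] at hw hwb
        obtain ⟨i, hi, h1⟩ := hw
        obtain ⟨j, hj, h2⟩ := hwb
        obtain rfl := (h.inj a ha b (hHX b hb) i hi j hj (h1.trans h2.symm)).1
        simp only [H, Finset.mem_union, Set.Finite.mem_toFinset, Set.mem_ofPred_eq] at hb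
        rcases hb with hb | hb
        · obtain ⟨_, u, hu, hu'⟩ := hb
          exact haH.1 ha u hu hu'
        · exact haH.2 ha hb.2
    have hHVH : ∀ a ∈ insert x H, a ∈ VH := by
      intro a ha
      rw [Finset.mem_insert] at ha
      rcases ha with rfl | ha
      · simp [VH]
      · simp only [VH, Finset.mem_insert, Finset.mem_union, Finset.mem_biUnion]
        exact .inr (.inr ⟨a, ha, (hsp a a).2 ⟨0, by omega, h.zero a (hHX a ha)⟩⟩)
    have hspVH : ∀ a ∈ H, ∀ w ∈ sp a, w ∈ VH := by
      intro a ha w hw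
      simp only [VH, Finset.mem_insert, Finset.mem_union, Finset.mem_biUnion]
      exact .inr (.inr ⟨a, ha, hw⟩)
    let EH : Finset (W × W) := (VH ×ˢ VH).filter (· ∈ E)
    have hEH : ∀ {u v}, (u, v) ∈ (EH : Set (W × W)) ↔ (u ∈ VH ∧ v ∈ VH) ∧ (u, v) ∈ E := by
      intro u v; simp [EH]
    have hto : ∀ {C : Set W} {a b : W}, Reach E C a b → C ⊆ VH → Reach (EH : Set (W × W)) C a b := by
      intro C a b hR hC
      exact hR.ind (P := fun b => Reach (EH : Set (W × W)) C a b) (fun h => .refl h)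
        fun u v hu he hv ih => ih.tail (hEH.2 ⟨⟨hC hu.mem_right, hC hv⟩, he⟩) hv
    have hfrom : ∀ {C : Set W} {a b : W}, Reach (EH : Set (W × W)) C a b → a ∈ VH →
        Reach E (C ∩ VH) a b := by
      intro C a b hR ha
      exact hR.ind (P := fun b => Reach E (C ∩ VH) a b) (fun h => .refl ⟨h, ha⟩)
        fun u v hu he hv ih => ih.tail (hEH.1 he).2 ⟨hv, (hEH.1 he).1.2⟩
    have hnot : ¬ Conn (EH : Set (W × W)) ((insert x H : Finset W) : Set W) Y (insert x H).card := by
      rintro ⟨f, hf, hr⟩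
      choose fa hfa fb hfb hR using hr
      have hinj : Function.Injective fa := by
        intro i j hij
        by_contra hne
        exact Set.disjoint_left.1 (hf hne) (hR i).mem_left (hij ▸ (hR j).mem_left)
      have himg : Finset.univ.image fa = insert x H := by
        apply Finset.eq_of_subset_of_card_le
        · intro a ha
          simp only [Finset.mem_image, Finset.mem_univ, true_and] at ha
          obtain ⟨i, rfl⟩ := ha
          exact_mod_cast hfa i
        · rw [Finset.card_image_of_injective _ hinj]; simp
      have hsurj : ∀ a ∈ insert x H, ∃ i, fa i = a := by
        intro a ha
        rw [← himg] at ha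
        simpa using ha
      apply hn
      refine ⟨fun a => if ha : a ∈ insert x H then
        f (Classical.choose (show ∃ i, fa i = a by
          rw [← himg] at ha; simpa using ha)) ∩ VH else sp a, ?_, ?_⟩
      · intro a ha
        by_cases haH : a ∈ insert x H
        · simp only [haH, dif_pos]
          generalize_proofs pf
          have hsp' := Classical.choose_spec pf
          generalize Classical.choose pf = i at *
          subst hsp'
          exact ⟨fb i, hfb i, hfrom (hR i) (hHVH _ haH)⟩
        · simp only [haH, dif_neg, not_false_eq_true]
          have haX : a ∈ X := by
            rcases ha with rfl | ha
            · simp at haH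
            · exact ha
          refine ⟨p a (n a), h.last a haX, ?_⟩
          have := h.seg (C := (sp a : Set W)) haX (Nat.zero_le _) le_rfl
            (fun k _ hk => by exact_mod_cast (hsp a _).2 ⟨k, hk, rfl⟩)
          rwa [h.zero a haX] at this
      · intro a ha b hb hab
        have hX' : ∀ a ∈ insert x X, a ∉ insert x H → a ∈ X ∧ a ∉ H := by
          rintro a (rfl | ha) ha'
          · simp at ha'
          · exact ⟨ha, fun h => ha' (by simp [h])⟩
        by_cases haH : a ∈ insert x H <;> by_cases hbH : b ∈ insert x H
        · simp only [haH, hbH, dif_pos]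
          generalize_proofs pf1 pf2
          have h1 := Classical.choose_spec pf1
          have h2 := Classical.choose_spec pf2
          refine (hf ?_).mono Set.inter_subset_left Set.inter_subset_left
          intro heq
          rw [heq] at h1
          exact hab (h1.symm.trans h2)
        · simp only [haH, hbH, dif_pos, dif_neg, not_false_eq_true]
          obtain ⟨h1, h2⟩ := hX' b hb hbH
          rw [Set.disjoint_left]
          intro w hw hw'
          exact hVH b h1 h2 w hw' hw.2
        · simp only [haH, hbH, dif_pos, dif_neg, not_false_eq_true]
          obtain ⟨h1, h2⟩ := hX' a ha haH
          rw [Set.disjoint_left]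
          intro w hw hw'
          exact hVH a h1 h2 w hw hw'.2
        · simp only [haH, hbH, dif_neg, not_false_eq_true]
          obtain ⟨h1, _⟩ := hX' a ha haH
          obtain ⟨h2, _⟩ := hX' b hb hbH
          rw [Set.disjoint_left]
          intro w hw hw'
          obtain ⟨i, hi, h3⟩ := (hsp a w).1 hw
          obtain ⟨j, hj, h4⟩ := (hsp b w).1 hw'
          exact hab (h.inj a h1 b h2 i hi j hj (h3.trans h4.symm)).1
    have := mt (menger_aux _ EH rfl ((insert x H : Finset W) : Set W) Y (insert x H).card) hnot
    push Not at this
    obtain ⟨S, hSc, hS⟩ := this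
    -- S meets every path
    have hmeet : ∀ a ∈ H, ∃ i ≤ n a, p a i ∈ S := by
      intro a ha
      by_contra hcon
      push Not at hcon
      have h1 := h.seg (C := (sp a : Set W) ∩ (S : Set W)ᶜ) (hHX a ha) (Nat.zero_le _) le_rfl
        (fun k _ hk => ⟨by exact_mod_cast (hsp a _).2 ⟨k, hk, rfl⟩, by exact_mod_cast hcon k hk⟩)
      rw [h.zero a (hHX a ha)] at h1
      refine hS a (by simp [ha]) _ (h.last a (hHX a ha)) ((hto h1 ?_).mono Set.inter_subset_right)
      intro w hw
      exact_mod_cast hspVH a ha w hw.1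
    choose! t ht htS using hmeet
    have himg : H.image (fun a => p a (t a)) = S := by
      apply Finset.eq_of_subset_of_card_le
      · intro w hw
        rw [Finset.mem_image] at hw
        obtain ⟨a, ha, rfl⟩ := hw
        exact htS a ha
      · rw [Finset.card_image_of_injOn]
        · rw [Finset.card_insert_of_notMem hxH] at hSc; omega
        · intro a ha b hb heq
          exact (h.inj a (hHX a ha) b (hHX b hb) _ (ht a ha) _ (ht b hb) heq).1
    refine ⟨fun a => if ha : a ∈ H then ⟨t a, Nat.lt_succ_iff.2 (ht a ha)⟩ else 0, ?_⟩
    simp only [Set.mem_iInter]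
    rintro ⟨F, a, ha, b, hb, hR⟩ hFs
    have hFU : (F : Set W) ⊆ U := by
      intro w hw
      simp only [U, Finset.coe_biUnion, Set.mem_iUnion]
      exact ⟨_, hFs, hw⟩
    have haH : a ∈ insert x H := by
      rcases ha with rfl | ha
      · simp
      · simp only [Finset.mem_insert, H, Finset.mem_union, Set.Finite.mem_toFinset, Set.mem_ofPred_eq]
        exact .inr (.inl ⟨ha, a, hFU hR.mem_left, (hsp a a).2 ⟨0, by omega, h.zero a ha⟩⟩)
    have hex : ∃ u ∈ F, u ∈ S := by
      by_contra hcon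
      push Not at hcon
      refine hS a (by exact_mod_cast haH) b hb ((hto hR ?_).mono ?_)
      · intro w hw
        have := hFU hw
        simp only [VH, Finset.coe_insert, Finset.coe_union]
        exact .inr (.inl this)
      · intro w hw hw'
        exact hcon w (by exact_mod_cast hw) (by exact_mod_cast hw')
    obtain ⟨u, huF, huS⟩ := hex
    refine ⟨u, huF, ?_⟩
    rw [← himg, Finset.mem_image] at huS
    obtain ⟨c, hc, rfl⟩ := huS
    exact ⟨c, hHX c hc, by simp [hc]⟩

theorem exists_min {x : W} (h : PSys E X Y p n)
    (hex : ∃ τ : W → ℕ, (∀ a, τ a ≤ n a) ∧ VSep E (insert x X) Y (Tr X p τ)) :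
    ∃ τ : W → ℕ, (∀ a, τ a ≤ n a) ∧ VSep E (insert x X) Y (Tr X p τ) ∧
      ∀ σ : W → ℕ, (∀ a, σ a ≤ n a) → VSep E (insert x X) Y (Tr X p σ) → ∀ a, τ a ≤ σ a := by
  classical
  let G : Set (W → ℕ) := {τ | (∀ a, τ a ≤ n a) ∧ VSep E (insert x X) Y (Tr X p τ)}
  obtain ⟨σ0, hσ0⟩ : G.Nonempty := hex
  have hatt : ∀ a, ∃ σ ∈ G, ∀ σ' ∈ G, σ a ≤ σ' a := by
    intro a
    obtain ⟨σ, hσ⟩ := exists_minimalFor_of_wellFoundedLT (· ∈ G) (fun σ : W → ℕ => σ a) ⟨σ0, hσ0⟩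
    refine ⟨σ, hσ.1, fun σ' hσ' => ?_⟩
    by_contra hlt
    exact hlt (hσ.2 hσ' (by show σ' a ≤ σ a; omega))
  choose m hmG hm using hatt
  let τ : W → ℕ := fun a => m a a
  have hτn : ∀ a, τ a ≤ n a := fun a => (hmG a).1 a
  let Af : Set W := {w | ∃ c ∈ X, ∃ j, τ c ≤ j ∧ j ≤ n c ∧ p c j = w}
  have hsub : ∀ σ ∈ G, Tr X p σ ⊆ Af := by
    rintro σ hσ w ⟨c, hc, rfl⟩
    exact ⟨c, hc, σ c, hm c σ hσ, hσ.1 c, rfl⟩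
  have hAf : ∀ w ∈ Af, w ∉ Tr X p τ → ∃ σ ∈ G, ∃ b ∈ Y, Reach E (Tr X p σ)ᶜ w b := by
    rintro w ⟨c, hc, j, h1, h2, rfl⟩ hw
    have hne : τ c ≠ j := by rintro rfl; exact hw ⟨c, hc, rfl⟩
    refine ⟨m c, hmG c, _, h.last c hc, h.seg hc h2 le_rfl ?_⟩
    rintro k hk1 hk2 ⟨d, hd, heq⟩
    obtain ⟨rfl, heq⟩ := h.inj d hd c hc _ ((hmG c).1 d) k hk2 heq
    have : m d d = τ d := rfl
    omega
  refine ⟨τ, hτn, ?_, fun σ h1 h2 a => hm a σ ⟨h1, h2⟩⟩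
  intro a ha b hb hR
  have : Reach E Afᶜ a b := by
    refine hR.ind (P := fun b => Reach E Afᶜ a b) ?_ ?_
    · intro h0
      refine .refl fun hA => ?_
      obtain ⟨σ, hσ, b', hb', hR'⟩ := hAf a hA h0
      exact hσ.2 a ha b' hb' hR'
    · intro u v hu he hv ih
      refine ih.tail he fun hA => ?_
      obtain ⟨σ, hσ, b', hb', hR'⟩ := hAf v hA hv
      refine hσ.2 a ha b' hb' (((ih.mono ?_).tail he hR'.mem_left).trans hR')
      exact Set.compl_subset_compl.2 (hsub σ hσ)
  exact hσ0.2 a ha b hb (this.mono (Set.compl_subset_compl.2 (hsub σ0 hσ0)))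

theorem glue {A : Set W} (h : PSys E X Y p n) {τ : W → ℕ} (hτ : ∀ a ∈ X, τ a ≤ n a)
    (hS : VSep E A Y (Tr X p τ)) (hj : WJ E A (Tr X p τ)) : WJ E A Y := by
  classical
  obtain ⟨f, hf, hd⟩ := hj
  have hcut : ∀ a ∈ A, ∃ c ∈ X, ∃ C' ⊆ f a, Reach E C' a (p c (τ c)) ∧
      ∀ w ∈ C', w ≠ p c (τ c) → Reach E (f a ∩ (Tr X p τ)ᶜ) a w := by
    intro a ha
    obtain ⟨b, hb, hR⟩ := hf a ha
    obtain ⟨z, ⟨c, hc, rfl⟩, C', h1, h2, h3⟩ := hR.cut hb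
    exact ⟨c, hc, C', h1, h2, h3⟩
  choose! c hc C' hC' hR hw using hcut
  have hcross : ∀ a ∈ A, ∀ b ∈ A, a ≠ b → ∀ w ∈ C' a, ∀ j, τ (c b) ≤ j → j ≤ n (c b) →
      p (c b) j ≠ w := by
    rintro a ha b hb hab w hwa j h1 h2 rfl
    by_cases hjτ : j = τ (c b)
    · subst hjτ
      exact Set.disjoint_left.1 (hd a ha b hb hab) (hC' a ha hwa) (hC' b hb (hR b hb).mem_right)
    · have hnT : ∀ k, j ≤ k → k ≤ n (c b) → p (c b) k ∈ (Tr X p τ)ᶜ := by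
        rintro k hk1 hk2 ⟨d, hd', heq⟩
        obtain ⟨rfl, heq⟩ := h.inj d hd' _ (hc b hb) _ (hτ d hd') k hk2 heq
        omega
      have hne : p (c b) j ≠ p (c a) (τ (c a)) := fun heq =>
        hnT j le_rfl h2 ⟨c a, hc a ha, heq.symm⟩
      exact hS a ha _ (h.last _ (hc b hb))
        (((hw a ha _ hwa hne).mono Set.inter_subset_right).trans (h.seg (hc b hb) h2 le_rfl hnT))
  refine ⟨fun a => C' a ∪ {w | ∃ j, τ (c a) ≤ j ∧ j ≤ n (c a) ∧ p (c a) j = w}, ?_, ?_⟩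
  · intro a ha
    refine ⟨_, h.last _ (hc a ha), ((hR a ha).mono Set.subset_union_left).trans
      (h.seg (hc a ha) (hτ _ (hc a ha)) le_rfl fun k h1 h2 => .inr ⟨k, h1, h2, rfl⟩)⟩
  · intro a ha b hb hab
    have hcab : c a ≠ c b := by
      intro heq
      refine hcross a ha b hb hab _ (hR a ha).mem_right (τ (c b)) le_rfl (hτ _ (hc b hb)) ?_
      rw [heq]
    rw [Set.disjoint_left]
    rintro w (h1 | ⟨i, hi1, hi2, rfl⟩) (h2 | ⟨j, hj1, hj2, hj3⟩)
    · exact Set.disjoint_left.1 (hd a ha b hb hab) (hC' a ha h1) (hC' b hb h2)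
    · exact hcross a ha b hb hab _ h1 j hj1 hj2 hj3
    · exact hcross b hb a ha hab.symm _ h2 i hi1 hi2 rfl
    · exact hcab (h.inj _ (hc b hb) _ (hc a ha) j hj2 i hi2 hj3).1.symm

theorem Reach.map {W' : Type*} {E' : Set (W' × W')} {D : Set W'} (φ : W → W')
    (hE : ∀ u v, u ∈ C → v ∈ C → (u, v) ∈ E → (φ u, φ v) ∈ E') (hC : ∀ u ∈ C, φ u ∈ D)
    (h : Reach E C a b) : Reach E' D (φ a) (φ b) :=
  h.ind (P := fun b => Reach E' D (φ a) (φ b)) (fun h => .refl (hC _ h))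
    fun _ _ hu he hv ih => ih.tail (hE _ _ hu.mem_right hv he) (hC _ hv)

/-- The digraph with the vertex `s` doubled; the copy `none` is a sink. -/
def Dbl {W : Type*} (E : Set (W × W)) (s : W) : Set (Option W × Option W) :=
  {e | ∃ u, e.1 = some u ∧ ((∃ v, e.2 = some v ∧ (u, v) ∈ E) ∨ (e.2 = none ∧ (u, s) ∈ E))}

theorem double {x s : W} (hx : x ∉ X) (h : PSys E X Y p n) {τ : W → ℕ} (hτ : ∀ a, τ a ≤ n a)
    (hS : VSep E (insert x X) Y (Tr X p τ))
    (hmin : ∀ σ : W → ℕ, (∀ a, σ a ≤ n a) → VSep E (insert x X) Y (Tr X p σ) → ∀ a, τ a ≤ σ a)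
    (hs : s ∈ Tr X p τ) (hsX : s ∉ X) :
    ∃ f : W → Set W, (∀ a ∈ insert x X, ∃ b ∈ Tr X p τ, Reach E (f a) a b) ∧
      ∀ a ∈ insert x X, ∀ b ∈ insert x X, a ≠ b → f a ∩ f b ⊆ {s} := by
  classical
  let p2 : Option W → ℕ → Option W := fun a i => a.map fun a => p a i
  let n2 : Option W → ℕ := fun a => a.elim 0 τ
  let Y2 : Set (Option W) := insert none (some '' Tr X p τ)
  have hE2 : ∀ u v, (u, v) ∈ E → (some u, some v) ∈ Dbl E s := fun u v huv =>
    ⟨u, rfl, .inl ⟨v, rfl, huv⟩⟩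
  have hP2 : PSys (Dbl E s) (some '' X) Y2 p2 n2 := by
    constructor
    · rintro _ ⟨a, ha, rfl⟩
      simp [p2, h.zero a ha]
    · rintro _ ⟨a, ha, rfl⟩ i hi
      exact hE2 _ _ (h.edge a ha i (lt_of_lt_of_le hi (hτ a)))
    · rintro _ ⟨a, ha, rfl⟩
      exact .inr ⟨_, ⟨a, ha, rfl⟩, rfl⟩
    · rintro _ ⟨a, ha, rfl⟩ _ ⟨b, hb, rfl⟩ i hi j hj heq
      have := h.inj a ha b hb i (le_trans hi (hτ a)) j (le_trans hj (hτ b)) (Option.some.inj heq)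
      exact ⟨by rw [this.1], this.2⟩
  have hx2 : (some x) ∉ some '' X := by simpa using hx
  by_cases hj : WJ (Dbl E s) (insert (some x) (some '' X)) Y2
  · obtain ⟨f, hf, hd⟩ := hj
    let φ : Option W → W := fun o => o.getD s
    have hmem : ∀ a ∈ insert x X, some a ∈ insert (some x) (some '' X) := by
      rintro a (rfl | ha)
      · exact .inl rfl
      · exact .inr ⟨a, ha, rfl⟩
    refine ⟨fun a => φ '' f (some a), ?_, ?_⟩
    · intro a ha
      obtain ⟨b, hb, hR⟩ := hf (some a) (hmem a ha)
      refine ⟨φ b, ?_, ?_⟩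
      · rcases hb with rfl | ⟨b, hb, rfl⟩
        · exact hs
        · exact hb
      · refine hR.map (D := φ '' f (some a)) φ ?_ (fun u hu => ⟨u, hu, rfl⟩)
        rintro u v _ _ ⟨u', h1, ⟨v', h2, h3⟩ | ⟨h2, h3⟩⟩ <;>
        · dsimp only at h1 h2
          subst h1 h2
          exact h3
    · rintro a ha b hb hab w ⟨⟨u, hu, hu'⟩, ⟨v, hv, hv'⟩⟩
      have hne : u ≠ v := by
        rintro rfl
        exact Set.disjoint_left.1 (hd _ (hmem a ha) _ (hmem b hb) (by simpa using hab)) hu hv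
      cases u with
      | none => exact hu'.symm
      | some u =>
        cases v with
        | none => exact hv'.symm
        | some v =>
          exact absurd (congrArg some (hu'.trans hv'.symm)) hne
  · exfalso
    obtain ⟨σ2, hσ2, hsep⟩ := bb hx2 hP2 hj
    let σ : W → ℕ := fun a => σ2 (some a)
    have hσ : ∀ a, σ a ≤ τ a := fun a => hσ2 (some a)
    have hTr : Tr (some '' X) p2 σ2 = some '' Tr X p σ := by
      ext w
      constructor
      · rintro ⟨_, ⟨a, ha, rfl⟩, rfl⟩
        exact ⟨_, ⟨a, ha, rfl⟩, rfl⟩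
      · rintro ⟨_, ⟨a, ha, rfl⟩, rfl⟩
        exact ⟨_, ⟨a, ha, rfl⟩, rfl⟩
    rw [hTr] at hsep
    have hmem : ∀ a ∈ insert x X, some a ∈ insert (some x) (some '' X) := by
      rintro a (rfl | ha)
      · exact .inl rfl
      · exact .inr ⟨a, ha, rfl⟩
    have hσsep : VSep E (insert x X) Y (Tr X p σ) := by
      intro a ha b hb hR
      have hex : ∃ z ∈ Tr X p τ, Reach E (Tr X p σ)ᶜ a z := by
        by_contra hcon
        push Not at hcon
        refine hS a ha b hb (hR.restrict.mono ?_)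
        intro w hw hw'
        exact hcon w hw' hw
      obtain ⟨z, hz, hRz⟩ := hex
      refine hsep (some a) (hmem a ha) (some z) (.inr ⟨z, hz, rfl⟩)
        (hRz.map some (fun u v _ _ h => hE2 u v h) ?_)
      rintro u hu ⟨v, hv, hvu⟩
      exact hu (Option.some.inj hvu ▸ hv)
    have heq : σ = τ := by
      funext a
      exact le_antisymm (hσ a) (hmin σ (fun a => (hσ a).trans (hτ a)) hσsep a)
    rw [heq] at hsep
    obtain ⟨a, ha, rfl⟩ := hs
    have hpos : τ a ≠ 0 := by
      intro h0
      rw [h0, h.zero a ha] at hsX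
      exact hsX ha
    obtain ⟨k, hk⟩ := Nat.exists_eq_succ_of_ne_zero hpos
    have h1 := h.seg (C := (Tr X p τ)ᶜ) ha (Nat.zero_le k) (by have := hτ a; omega) (by
      rintro j _ hjk ⟨d, hd, heq⟩
      have := hτ a
      obtain ⟨rfl, heq⟩ := h.inj d hd a ha _ (hτ d) j (by omega) heq
      omega)
    rw [h.zero a ha] at h1
    have h2 : Reach (Dbl E (p a (τ a))) (some '' Tr X p τ)ᶜ (some a) (some (p a k)) :=
      h1.map some (fun u v _ _ h => hE2 u v h) (by
        rintro u hu ⟨v, hv, hvu⟩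
        exact hu (Option.some.inj hvu ▸ hv))
    refine hsep (some a) (hmem a (.inr ha)) none (.inl rfl) (h2.tail ?_ (by simp))
    refine ⟨_, rfl, .inr ⟨rfl, ?_⟩⟩
    have := h.edge a ha k (by have := hτ a; omega)
    rwa [hk]

/-- The abstract core. -/
theorem core {x s : W} (hx : x ∉ X) (h : PSys E X Y p n) {τ : W → ℕ} (hτ : ∀ a, τ a ≤ n a)
    (hS : VSep E (insert x X) Y (Tr X p τ))
    (hmin : ∀ σ : W → ℕ, (∀ a, σ a ≤ n a) → VSep E (insert x X) Y (Tr X p σ) → ∀ a, τ a ≤ σ a)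
    (hn : ¬ WJ E (insert x X) Y)
    (hs : s ∈ Tr X p τ) (hsX : s ∉ X) {q : W → ℕ → W} {m : W → ℕ}
    (hq : PSys E X (Tr X p τ) q m) (hsq : ∀ a ∈ X, ∀ i ≤ m a, q a i ≠ s) : False := by
  obtain ⟨f, hf, hd⟩ := double hx h hτ hS hmin hs hsX
  have hn2 : ¬ WJ E (insert x X) (Tr X p τ) := fun hj => hn (glue h (fun a _ => hτ a) hS hj)
  obtain ⟨σ, hσ, hT⟩ := bb hx hq hn2
  have hsT : s ∉ Tr X q σ := by
    rintro ⟨a, ha, heq⟩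
    exact hsq a ha _ (hσ a) heq
  refine hn2 (glue hq (fun a _ => hσ a) hT ?_)
  have hcut : ∀ a ∈ insert x X, ∃ z ∈ Tr X q σ, ∃ C' ⊆ f a, s ∉ C' ∧ Reach E C' a z := by
    intro a ha
    obtain ⟨b, hb, hR⟩ := hf a ha
    obtain ⟨z, hz, C', hC', h1, h2⟩ := hR.cut (Z := Tr X q σ ∪ Tr X p τ) (.inr hb)
    by_cases hzT : z ∈ Tr X q σ
    · refine ⟨z, hzT, C', hC', ?_, h1⟩
      intro hsC
      have hne : s ≠ z := by rintro rfl; exact hsT hzT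
      exact (h2 s hsC hne).mem_right.2 (.inr hs)
    · exfalso
      refine hT a ha z (hz.resolve_left hzT) (h1.mono ?_)
      intro w hw hwT
      by_cases hwz : w = z
      · exact hzT (hwz ▸ hwT)
      · exact (h2 w hw hwz).mem_right.2 (.inl hwT)
  choose! z hz C' hC' hsC hR using hcut
  refine ⟨C', fun a ha => ⟨z a, hz a ha, hR a ha⟩, ?_⟩
  intro a ha b hb hab
  rw [Set.disjoint_left]
  intro w hwa hwb
  have := hd a ha b hb hab ⟨hC' a ha hwa, hC' b hb hwb⟩
  rw [Set.mem_singleton_iff] at this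
  exact hsC a ha (this ▸ hwa)

/-! ### Conversion to and from directed paths -/

theorem Reach.dipath {V : Type u} {E : Set (V × V)} {C : Set V} {a b : V} (h : Reach E C a b) :
    ∃ d : Dipath E, d.start = a ∧ d.last = b ∧ d.support ⊆ C := by
  obtain ⟨h1, h2⟩ := h
  revert h1
  induction h2 using Relation.ReflTransGen.head_induction_on with
  | refl =>
    intro h1
    refine ⟨⟨b, [], List.isChain_singleton _, by simp⟩, rfl, rfl, ?_⟩
    intro w hw
    simp only [Dipath.support, Dipath.verts, Set.mem_ofPred_eq, List.mem_singleton] at hw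
    exact hw ▸ h1
  | @head a c hac hcb ih =>
    intro ha
    obtain ⟨d, hd1, hd2, hd3⟩ := ih hac.2
    by_cases hmem : a ∈ d.start :: d.rest
    · obtain ⟨l1, l2, hl⟩ := List.append_of_mem hmem
      have hc : List.IsChain (fun a b => (a, b) ∈ E) (d.start :: d.rest) := d.chain
      have hnd := d.nodup
      refine ⟨⟨a, l2, ?_, ?_⟩, rfl, ?_, ?_⟩
      · rw [hl] at hc
        exact (List.isChain_append.1 hc).2.1
      · rw [hl] at hnd
        exact (List.nodup_append.1 hnd).2.1
      · rw [← hd2]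
        simp only [Dipath.last, hl]
        rw [List.getLast_append_of_ne_nil]
      · intro w hw
        apply hd3
        simp only [Dipath.support, Dipath.verts, Set.mem_ofPred_eq] at hw ⊢
        rw [hl]
        exact List.mem_append_right _ hw
    · refine ⟨⟨a, d.start :: d.rest, ?_, ?_⟩, rfl, ?_, ?_⟩
      · exact List.isChain_cons_cons.2 ⟨hd1 ▸ hac.1, d.chain⟩
      · exact List.nodup_cons.2 ⟨hmem, d.nodup⟩
      · rw [← hd2]
        simp [Dipath.last]
      · intro w hw
        simp only [Dipath.support, Dipath.verts, Set.mem_ofPred_eq, List.mem_cons] at hw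
        rcases hw with rfl | hw
        · exact ha
        · apply hd3
          simpa [Dipath.support, Dipath.verts] using hw

/-- Vertices of a path by position. -/
def Dipath.at {V : Type u} {E : Set (V × V)} (d : Dipath E) (i : ℕ) : V := d.verts.getD i d.start

section dip
variable {V : Type u} {E : Set (V × V)} (d : Dipath E)

theorem Dipath.at_eq {i : ℕ} (hi : i ≤ d.rest.length) :
    d.at i = d.verts[i]'(by simp [Dipath.verts]; omega) := by
  unfold Dipath.at
  rw [List.getD_eq_getElem]

theorem Dipath.at_zero : d.at 0 = d.start := rfl

theorem Dipath.at_last : d.at d.rest.length = d.last := by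
  rw [d.at_eq le_rfl]
  simp [Dipath.last, Dipath.verts, List.getLast_eq_getElem]

theorem Dipath.at_edge {i : ℕ} (hi : i < d.rest.length) : (d.at i, d.at (i + 1)) ∈ E := by
  rw [d.at_eq (by omega), d.at_eq (by omega)]
  have hc : List.IsChain (fun a b => (a, b) ∈ E) d.verts := d.chain
  exact List.isChain_iff_getElem.1 hc i (by simp [Dipath.verts]; omega)

theorem Dipath.at_inj {i j : ℕ} (hi : i ≤ d.rest.length) (hj : j ≤ d.rest.length)
    (h : d.at i = d.at j) : i = j := by
  rw [d.at_eq hi, d.at_eq hj] at h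
  exact (List.Nodup.getElem_inj_iff (show d.verts.Nodup from d.nodup)).1 h

theorem Dipath.mem_support {w : V} : w ∈ d.support ↔ ∃ i ≤ d.rest.length, d.at i = w := by
  constructor
  · intro hw
    obtain ⟨i, hi, rfl⟩ := List.getElem_of_mem (show w ∈ d.verts from hw)
    have : i ≤ d.rest.length := by simp [Dipath.verts] at hi; omega
    exact ⟨i, this, d.at_eq this⟩
  · rintro ⟨i, hi, rfl⟩
    rw [d.at_eq hi]
    exact List.getElem_mem _

theorem Dipath.mem_internal {w : V} (hw : w ∈ d.internal) :
    ∃ i, 0 < i ∧ i < d.rest.length ∧ d.at i = w := by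
  obtain ⟨i, hi, rfl⟩ := List.getElem_of_mem (show w ∈ d.rest.dropLast from hw)
  rw [List.length_dropLast] at hi
  refine ⟨i + 1, by omega, by omega, ?_⟩
  rw [d.at_eq (by omega)]
  simp [Dipath.verts]

theorem Dipath.at_mem_internal {i : ℕ} (h0 : 0 < i) (hi : i < d.rest.length) :
    d.at i ∈ d.internal := by
  rw [d.at_eq hi.le]
  show _ ∈ d.rest.dropLast
  obtain ⟨j, rfl⟩ := Nat.exists_eq_succ_of_ne_zero h0.ne'
  rw [List.mem_iff_getElem]
  refine ⟨j, by rw [List.length_dropLast]; omega, ?_⟩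
  simp [Dipath.verts]

theorem Dipath.reach {C : Set V} (hC : d.support ⊆ C) : Reach E C d.start d.last := by
  have h : PSys E {d.start} {d.last} (fun _ => d.at) (fun _ => d.rest.length) := by
    constructor
    · rintro a rfl; rfl
    · rintro a rfl i hi; exact d.at_edge hi
    · rintro a rfl; exact d.at_last
    · rintro a rfl b rfl i hi j hj heq; exact ⟨rfl, d.at_inj hi hj heq⟩
  have := h.seg (C := C) rfl (Nat.zero_le _) le_rfl fun k _ hk => hC (d.mem_support.2 ⟨k, hk, rfl⟩)
  rwa [d.at_zero, d.at_last] at this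

/-- A path system covering `X` gives an indexed system. -/
theorem toPSys {X Y : Set V} {P : Set (Dipath E)} (hP : IsXYSystem E X Y P) (hi : initVerts P = X) :
    ∃ g : V → Dipath E, (∀ a ∈ X, g a ∈ P ∧ (g a).start = a) ∧ (∀ d ∈ P, g d.start = d) ∧
      PSys E X Y (fun a => (g a).at) (fun a => (g a).rest.length) := by
  classical
  have hex : ∀ a ∈ X, ∃ d ∈ P, d.start = a := by
    intro a ha
    rw [← hi] at ha
    exact ha
  let g : V → Dipath E := fun a => if h : a ∈ X then Classical.choose (hex a h)
    else ⟨a, [], List.isChain_singleton _, by simp⟩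
  have hg : ∀ a ∈ X, g a ∈ P ∧ (g a).start = a := by
    intro a ha
    simp only [g, ha, dif_pos]
    exact Classical.choose_spec (hex a ha)
  refine ⟨g, hg, ?_, ?_⟩
  · intro d hd
    have hdX : d.start ∈ X := hi ▸ ⟨d, hd, rfl⟩
    by_contra hne
    have h1 : d.start ∈ (g d.start).support :=
      (g d.start).mem_support.2 ⟨0, Nat.zero_le _, (hg _ hdX).2⟩
    exact Set.disjoint_left.1 (hP.2 (hg _ hdX).1 hd hne) h1
      (d.mem_support.2 ⟨0, Nat.zero_le _, rfl⟩)
  · constructor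
    · intro a ha; exact (hg a ha).2
    · intro a ha i hi; exact (g a).at_edge hi
    · intro a ha
      have := (hP.1 _ (hg a ha).1).2.1
      rwa [← Dipath.at_last] at this
    · intro a ha b hb i hi j hj heq
      have hgab : g a = g b := by
        by_contra hne
        exact Set.disjoint_left.1 (hP.2 (hg _ ha).1 (hg b hb).1 hne)
          ((g a).mem_support.2 ⟨i, hi, rfl⟩) ((g b).mem_support.2 ⟨j, hj, heq.symm⟩)
      have hab : a = b := by rw [← (hg a ha).2, ← (hg b hb).2, hgab]
      subst hab
      exact ⟨rfl, (g a).at_inj hi hj heq⟩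

/-- A weak family gives joinability. -/
theorem toJoinable {X Y : Set V} (f : V → Set V) (hX : ∀ e ∈ E, e.2 ∉ X)
    (hf : ∀ a ∈ X, ∃ b ∈ Y, Reach E (f a) a b ∧
      ∀ d : Dipath E, d.support ⊆ f a → d.last = b → ∀ w ∈ d.internal, w ∉ Y)
    (hd : ∀ a ∈ X, ∀ b ∈ X, a ≠ b → Disjoint (f a) (f b)) : Joinable E X Y := by
  choose! b hb hR hinner using hf
  have hdp : ∀ a, ∃ d : Dipath E, a ∈ X → d.start = a ∧ d.last = b a ∧ d.support ⊆ f a := by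
    intro a
    by_cases ha : a ∈ X
    · obtain ⟨d, hd⟩ := (hR a ha).dipath
      exact ⟨d, fun _ => hd⟩
    · exact ⟨⟨a, [], List.isChain_singleton _, by simp⟩, fun h => absurd h ha⟩
  choose d hdd using hdp
  have h1 := fun a ha => (hdd a ha).1
  have h2 := fun a ha => (hdd a ha).2.1
  have h3 := fun a ha => (hdd a ha).2.2
  refine ⟨d '' X, ⟨?_, ?_⟩, ?_⟩
  · rintro _ ⟨a, ha, rfl⟩
    refine ⟨by rw [h1 a ha]; exact ha, by rw [h2 a ha]; exact hb a ha, ?_⟩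
    rintro w hw (hw' | hw')
    · obtain ⟨i, hi0, hi, rfl⟩ := (d a).mem_internal hw
      obtain ⟨j, rfl⟩ := Nat.exists_eq_succ_of_ne_zero hi0.ne'
      exact hX _ ((d a).at_edge (i := j) (by omega)) hw'
    · exact hinner a ha (d a) (h3 a ha) (h2 a ha) w hw hw'
  · rintro _ ⟨a, ha, rfl⟩ _ ⟨b, hb, rfl⟩ hne
    have hab : a ≠ b := by rintro rfl; exact hne rfl
    exact (hd a ha b hb hab).mono (h3 a ha) (h3 b hb)
  · ext w
    constructor
    · rintro ⟨_, ⟨a, ha, rfl⟩, rfl⟩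
      rw [h1 a ha]; exact ha
    · intro hw
      exact ⟨_, ⟨w, hw, rfl⟩, h1 w hw⟩

end dip

end Aux

/-- If `X - x` is joinable to `Y` but `X` is not, then there is an Erdős–Menger
`(X,Y)`-separation `S` such that `X - x` is incompressible to `S`. -/
theorem stmt4 {V : Type u} (E : Set (V × V)) (X Y : Set V)
    (hX : ∀ e ∈ E, e.2 ∉ X) (hY : ∀ e ∈ E, e.1 ∉ Y)
    (x : V) (hx : x ∈ X)
    (hjoin : Joinable E (X \ {x}) Y) (hnjoin : ¬ Joinable E X Y) :
    ∃ S : Set V, IsEMXYSeparation E X Y S ∧ Incompressible E (X \ {x}) S := by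
  classical
  have hins : insert x (X \ {x}) = X := by
    rw [Set.insert_sdiff_singleton, Set.insert_eq_of_mem hx]
  have hxX' : x ∉ X \ {x} := fun h => h.2 rfl
  have hX' : ∀ e ∈ E, e.2 ∉ X \ {x} := fun e he h => hX e he h.1
  obtain ⟨P, hP, hPi⟩ := hjoin
  obtain ⟨g, hg, hgP, hsys⟩ := toPSys hP hPi
  -- `X` is not weakly joinable
  have hn : ¬ WJ E (insert x (X \ {x})) Y := by
    rw [hins]
    rintro ⟨f, hf, hd⟩
    apply hnjoin
    refine toJoinable f hX (fun a ha => ?_) hd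
    obtain ⟨b, hb, hR⟩ := hf a ha
    refine ⟨b, hb, hR, fun d _ _ w hw hwY => ?_⟩
    obtain ⟨i, _, hi, rfl⟩ := d.mem_internal hw
    exact hY _ (d.at_edge hi) hwY
  obtain ⟨τ, hτ, hS, hmin⟩ := exists_min hsys (bb hxX' hsys hn)
  set S := Tr (X \ {x}) (fun a => (g a).at) τ with hSdef
  have huniq : ∀ a ∈ X \ {x}, ∀ i ≤ (g a).rest.length, (g a).at i ∈ S → i = τ a := by
    rintro a ha i hi ⟨b, hb, heq⟩
    obtain ⟨rfl, h2⟩ := hsys.inj b hb a ha _ (hτ b) i hi heq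
    exact h2.symm
  refine ⟨S, ⟨?_, P, ⟨?_, hP.2⟩, ?_, ?_⟩, ?_, ?_⟩
  · -- separation
    intro d hd
    by_contra hcon
    rw [Set.not_nonempty_iff_eq_empty] at hcon
    refine hS d.start (hins.symm.subset hd.1) d.last hd.2.1 (d.reach ?_)
    intro w hw hwS
    have : w ∈ d.support ∩ S := ⟨hw, hwS⟩
    rw [hcon] at this
    exact this
  · -- the original paths are `(X,Y)`-paths
    intro d hd
    obtain ⟨h1, h2, h3⟩ := hP.1 d hd
    refine ⟨h1.1, h2, ?_⟩
    rintro w hw (hw' | hw')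
    · obtain ⟨i, hi0, hi, rfl⟩ := d.mem_internal hw
      obtain ⟨j, rfl⟩ := Nat.exists_eq_succ_of_ne_zero hi0.ne'
      exact hX _ (d.at_edge (i := j) (by omega)) hw'
    · exact h3 w hw (.inr hw')
  · -- each path meets `S` exactly once
    intro d hd
    have hdX : d.start ∈ X \ {x} := (hP.1 d hd).1
    have hgd := hgP d hd
    refine ⟨(g d.start).at (τ d.start), ⟨?_, d.start, hdX, rfl⟩, ?_⟩
    · have := (g d.start).mem_support.2 ⟨_, hτ d.start, rfl⟩
      rw [hgd] at this ⊢
      exact this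
    · rintro w ⟨hw, hwS⟩
      rw [← hgd] at hw
      obtain ⟨i, hi, rfl⟩ := (g d.start).mem_support.1 hw
      rw [huniq _ hdX i (by simpa [hgd] using hi) (by simpa [hgd] using hwS)]
  · rintro w ⟨a, ha, rfl⟩
    exact ⟨g a, (hg a ha).1, (g a).mem_support.2 ⟨_, hτ a, rfl⟩⟩
  · -- `X - x` is joinable to `S`
    refine toJoinable (fun a => {w | ∃ i ≤ τ a, (g a).at i = w}) hX' ?_ ?_
    · intro a ha
      have hR := hsys.seg (C := {w | ∃ i ≤ τ a, (g a).at i = w}) ha (Nat.zero_le _) (hτ a)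
        fun k _ hk => ⟨k, hk, rfl⟩
      rw [hsys.zero a ha] at hR
      refine ⟨_, ⟨a, ha, rfl⟩, hR, ?_⟩
      intro d hd1 hd2 w hw hwS
      obtain ⟨k, _, hk, rfl⟩ := d.mem_internal hw
      obtain ⟨i, hi, hieq⟩ := hd1 (d.mem_support.2 ⟨k, hk.le, rfl⟩)
      rw [← hieq] at hwS
      obtain rfl := huniq a ha i (hi.trans (hτ a)) hwS
      have : k = d.rest.length := d.at_inj hk.le le_rfl (by rw [d.at_last, hd2, ← hieq])
      omega
    · intro a ha b hb hab
      rw [Set.disjoint_left]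
      rintro w ⟨i, hi, rfl⟩ ⟨j, hj, heq⟩
      exact hab (hsys.inj b hb a ha j (hj.trans (hτ b)) i (hi.trans (hτ a)) heq).1.symm
  · -- incompressibility
    intro Q hQ hQi
    apply Set.Subset.antisymm
    · rintro _ ⟨d, hd, rfl⟩
      exact (hQ.1 d hd).2.1
    intro s hs
    by_contra hsQ
    obtain ⟨q, hq, hqQ, hqs⟩ := toPSys hQ hQi
    have hlast : ∀ a ∈ X \ {x}, (q a).last ≠ s := fun a ha heq => hsQ ⟨q a, (hq a ha).1, heq⟩
    have hinner : ∀ a ∈ X \ {x}, ∀ i, 0 < i → i < (q a).rest.length → (q a).at i ∉ S :=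
      fun a ha i h0 hi hiS => (hQ.1 _ (hq a ha).1).2.2 _ ((q a).at_mem_internal h0 hi) (.inr hiS)
    by_cases hsX : s ∈ X \ {x}
    · -- replace the path starting in `s` by a trivial one
      have hlen : (q s).rest.length ≠ 0 := by
        intro h0
        apply hlast s hsX
        rw [← Dipath.at_last, h0, Dipath.at_zero, (hq s hsX).2]
      have hlS : (q s).last ∈ S := (hQ.1 _ (hq s hsX).1).2.1
      have hlX : (q s).last ∉ X \ {x} := by
        obtain ⟨j, hj⟩ := Nat.exists_eq_succ_of_ne_zero hlen
        have := hX' _ ((q s).at_edge (i := j) (by omega))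
        rwa [← Dipath.at_last, hj]
      let m : V → ℕ := fun a => if a = s then 0 else (q a).rest.length
      have hm : ∀ a, m a ≤ (q a).rest.length := by
        intro a; simp only [m]; split_ifs <;> omega
      refine core hxX' hsys hτ hS hmin hn hlS hlX (q := fun a => (q a).at) (m := m) ?_ ?_
      · refine ⟨hqs.zero, fun a ha i hi => hqs.edge a ha i (hi.trans_le (hm a)), ?_,
          fun a ha b hb i hi j hj => hqs.inj a ha b hb i (hi.trans (hm a)) j (hj.trans (hm b))⟩
        intro a ha
        by_cases has : a = s
        · subst has
          simp only [m, if_true]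
          rw [Dipath.at_zero, (hq a ha).2]
          exact hs
        · simp only [m, if_neg has]
          exact hqs.last a ha
      · intro a ha i hi heq
        rw [← Dipath.at_last] at heq
        obtain ⟨rfl, rfl⟩ := hqs.inj a ha s hsX i (hi.trans (hm a)) _ le_rfl heq
        simp only [m, if_true] at hi
        omega
    · refine core hxX' hsys hτ hS hmin hn hs hsX hqs ?_
      intro a ha i hi heq
      rcases Nat.eq_zero_or_pos i with rfl | h0
      · rw [hqs.zero a ha] at heq
        exact hsX (heq ▸ ha)
      · rcases hi.lt_or_eq with h1 | rfl
        · exact hinner a ha i h0 h1 (heq ▸ hs)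
        · exact hlast a ha (by rw [← Dipath.at_last]; exact heq)
end

section
/- Let D be a digraph and X, Y vertex sets (vertices of X with no ingoing edges, vertices of Y with no outgoing edges). Let D' be obtained from D by deleting finitely many vertices and then finitely many edges. If X is incompressible to Y in D', then X is incompressible to Y in D. -/
/-!  Common framework: digraphs as edge sets on a vertex type, directed paths,
path-systems, separations, flames and largeness. -/

universe u

variable {V : Type u}

namespace Stmt6Aux

open Classical

/-- The unhappy front vertices of a state `C`. -/
def front (s pl : V → V → Prop) (VP C : Set V) : Set V :=
  {v | v ∈ C ∧ (∀ w, s v w → w ∉ C) ∧ (v ∉ VP ∨ ∃ w ∈ C, pl v w)}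

theorem exists_stable (s pl : V → V → Prop) (VP X : Set V)
    (hirr : ∀ a, ¬ pl a a)
    (htrans : ∀ a b c, pl a b → pl b c → pl a c)
    (htri : ∀ a b c, pl a c → pl b c → a = b ∨ pl a b ∨ pl b a)
    (hVP : ∀ a b, pl a b → b ∈ VP)
    (n : ℕ) (h0 : (front s pl VP X).encard ≤ n) :
    ∃ C, X ⊆ C ∧ (front s pl VP C).encard ≤ n ∧ ∀ v ∈ front s pl VP C, ∀ w, ¬ s v w := by
  obtain ⟨C, hXC, hC⟩ := zorn_subset_nonempty {C | (front s pl VP C).encard ≤ n} (by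
    intro c hc hch hne
    refine ⟨⋃₀ c, ?_, fun t ht => Set.subset_sUnion_of_mem ht⟩
    by_contra hcon
    simp only [Set.mem_ofPred_eq, not_le] at hcon
    have h1 : ((n + 1 : ℕ) : ℕ∞) ≤ (front s pl VP (⋃₀ c)).encard := by
      have := Order.add_one_le_of_lt hcon
      exact_mod_cast this
    obtain ⟨t, htS, htc⟩ := Set.exists_subset_encard_eq h1
    have htf : t.Finite := Set.finite_of_encard_eq_coe htc
    have hw : ∀ v : V, ∃ w, v ∈ t → w ∈ ⋃₀ c ∧ (v ∉ VP ∨ pl v w) := by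
      intro v
      by_cases hv : v ∈ t
      · obtain ⟨h1, h2, h3 | ⟨w, hw, h3⟩⟩ := htS hv
        · exact ⟨v, fun _ => ⟨h1, Or.inl h3⟩⟩
        · exact ⟨w, fun _ => ⟨hw, Or.inr h3⟩⟩
      · exact ⟨v, fun h => absurd h hv⟩
    choose g hg using hw
    have hF : (t ∪ g '' t).Finite := htf.union (htf.image g)
    have hsub : t ∪ g '' t ⊆ ⋃₀ c := by
      rintro v (hv | ⟨u, hu, rfl⟩)
      · exact (htS hv).1
      · exact (hg u hu).1
    obtain ⟨D, hD, hDs⟩ := DirectedOn.exists_mem_subset_of_finite_of_subset_sUnion hne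
      hch.directedOn hF hsub
    have ht : t ⊆ front s pl VP D := by
      intro v hv
      refine ⟨hDs (Or.inl hv), fun w hw hwD => (htS hv).2.1 w hw ⟨D, hD, hwD⟩, ?_⟩
      rcases (hg v hv).2 with h | h
      · exact Or.inl h
      · exact Or.inr ⟨g v, hDs (Or.inr ⟨v, hv, rfl⟩), h⟩
    have := (Set.encard_le_encard ht).trans (hc hD)
    rw [htc] at this
    have := ENat.natCast_le_natCast.1 this
    omega) X h0
  refine ⟨C, hXC, hC.prop, ?_⟩
  intro v hv w hs
  have hwC : w ∉ C := hv.2.1 w hs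
  have hvn : v ∉ front s pl VP (insert w C) := fun h => h.2.1 w hs (Set.mem_insert _ _)
  have key : ∃ u, front s pl VP (insert w C) ⊆ insert u (front s pl VP C \ {v}) := by
    by_cases hw : w ∈ VP ∧ ∀ w' ∈ C, ¬ pl w w'
    · have hwn : w ∉ front s pl VP (insert w C) := by
        rintro ⟨-, -, h3 | ⟨w', rfl | hw', h3⟩⟩
        · exact h3 hw.1
        · exact hirr _ h3
        · exact hw.2 _ hw' h3
      have main : ∃ u, ∀ z ∈ C, pl z w → (∀ w' ∈ C, ¬ pl z w') → z = u := by
        by_cases hu : ∃ u ∈ C, pl u w ∧ ∀ w' ∈ C, ¬ pl u w'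
        · obtain ⟨u, huC, huw, hum⟩ := hu
          refine ⟨u, fun z hz h3 h4 => ?_⟩
          rcases htri _ _ _ h3 huw with h | h | h
          · exact h
          · exact absurd h (h4 _ huC)
          · exact absurd h (hum _ hz)
        · exact ⟨v, fun z hz h3 h4 => absurd ⟨z, hz, h3, h4⟩ hu⟩
      obtain ⟨u, hu⟩ := main
      refine ⟨u, fun z hz => ?_⟩
      have hzv : z ≠ v := fun h => hvn (h ▸ hz)
      have hzw : z ≠ w := fun h => hwn (h ▸ hz)
      obtain ⟨h1, h2, h3⟩ := hz
      replace h1 : z ∈ C := h1.resolve_left hzw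
      by_cases hzu : z = u
      · exact Or.inl hzu
      refine Or.inr ⟨⟨h1, fun y hy hyC => h2 y hy (Or.inr hyC), ?_⟩, hzv⟩
      rcases h3 with h3 | ⟨w', rfl | hw', h3⟩
      · exact Or.inl h3
      · by_contra hcon
        push Not at hcon
        exact hzu (hu z (by assumption) h3 hcon.2)
      · exact Or.inr ⟨w', hw', h3⟩
    · refine ⟨w, fun z hz => ?_⟩
      have hzv : z ≠ v := fun h => hvn (h ▸ hz)
      obtain ⟨h1 | h1, h2, h3⟩ := hz
      · exact Or.inl h1
      refine Or.inr ⟨⟨h1, fun y hy hyC => h2 y hy (Or.inr hyC), ?_⟩, hzv⟩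
      rcases h3 with h3 | ⟨w', rfl | hw', h3⟩
      · exact Or.inl h3
      · push Not at hw
        obtain ⟨y, hy, hwy⟩ := hw (hVP _ _ h3)
        exact Or.inr ⟨y, hy, htrans _ _ _ h3 hwy⟩
      · exact Or.inr ⟨w', hw', h3⟩
  obtain ⟨u, hu⟩ := key
  have hle : (front s pl VP (insert w C)).encard ≤ n := by
    calc _ ≤ (insert u (front s pl VP C \ {v})).encard := Set.encard_le_encard hu
      _ ≤ (front s pl VP C \ {v}).encard + 1 := Set.encard_insert_le _ _
      _ = (front s pl VP C).encard := Set.encard_sdiff_singleton_add_one hv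
      _ ≤ n := hC.prop
  exact hwC (hC.le_of_ge hle (Set.subset_insert _ _) (Set.mem_insert _ _))

theorem split_list (C : Set V) : ∀ (l : List V) (a : V), a ∈ C →
    ∃ l1 v l2, a :: l = l1 ++ v :: l2 ∧ (∀ u ∈ l1, u ∈ C) ∧ v ∈ C ∧ ∀ w l3, l2 = w :: l3 → w ∉ C
  | [], a, ha => ⟨[], a, [], by simp, by simp, ha, by simp⟩
  | b :: l, a, ha => by
    by_cases hb : b ∈ C
    · obtain ⟨l1, v, l2, h1, h2, h3, h4⟩ := split_list C l b hb
      refine ⟨a :: l1, v, l2, by simp [h1], ?_, h3, h4⟩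
      intro u hu
      rcases List.mem_cons.1 hu with rfl | hu
      · exact ha
      · exact h2 u hu
    · refine ⟨[], a, b :: l, by simp, by simp, ha, ?_⟩
      intro w l3 h
      cases h
      exact hb

theorem exists_dipath {E : Set (V × V)} (l : List V) (hne : l ≠ [])
    (hc : l.IsChain (fun a b => (a, b) ∈ E)) (hn : l.Nodup) :
    ∃ r : Dipath E, r.verts = l := by
  cases l with
  | nil => exact absurd rfl hne
  | cons a l => exact ⟨⟨a, l, hc, hn⟩, rfl⟩

theorem chain' {E : Set (V × V)} (p : Dipath E) :
    p.verts.IsChain (fun a b => (a, b) ∈ E) := p.chain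

theorem nodup' {E : Set (V × V)} (p : Dipath E) : p.verts.Nodup := p.nodup

theorem last_eq {E : Set (V × V)} (p : Dipath E) (l : List V) (v : V) (h : p.verts = l ++ [v]) :
    p.last = v := by
  have : p.last = p.verts.getLast (by simp [Dipath.verts]) := rfl
  rw [this]
  simp [h]

theorem last_mem {E : Set (V × V)} (p : Dipath E) : p.last ∈ p.support :=
  List.getLast_mem (List.cons_ne_nil p.start p.rest)

theorem start_mem {E : Set (V × V)} (p : Dipath E) : p.start ∈ p.support := by
  simp [Dipath.support, Dipath.verts]

theorem in_edge {E : Set (V × V)} (p : Dipath E) (w : V) (hw : w ∈ p.rest) :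
    ∃ a, (a, w) ∈ E := by
  obtain ⟨l1, l2, h⟩ := List.append_of_mem hw
  have hc : (p.start :: (l1 ++ w :: l2)).IsChain (fun a b => (a, b) ∈ E) := h ▸ p.chain
  rcases List.eq_nil_or_concat l1 with rfl | ⟨l, a, rfl⟩
  · exact ⟨p.start, by simpa using (List.isChain_cons_cons.1 hc).1⟩
  · refine ⟨a, ?_⟩
    have : (p.start :: l ++ a :: w :: l2).IsChain (fun a b => (a, b) ∈ E) := by simpa using hc
    exact (List.isChain_append_cons_cons.1 this).2.1

theorem internal_edges {E : Set (V × V)} (p : Dipath E) (w : V) (hw : w ∈ p.internal) :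
    (∃ a, (a, w) ∈ E) ∧ ∃ b, (w, b) ∈ E := by
  have hw : w ∈ p.rest.dropLast := hw
  refine ⟨in_edge p w (List.mem_of_mem_dropLast hw), ?_⟩
  obtain ⟨l1, l2, h⟩ := List.append_of_mem hw
  have hne : p.rest ≠ [] := by
    intro h0
    simp [h0] at hw
  have h2 := List.dropLast_append_getLast hne
  rw [h] at h2
  have hc := p.chain
  rw [List.Chain, ← h2] at hc
  cases l2 with
  | nil =>
    refine ⟨p.rest.getLast hne, ?_⟩
    have : (p.start :: l1 ++ w :: p.rest.getLast hne :: []).IsChain (fun a b => (a, b) ∈ E) := by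
      simpa using hc
    exact (List.isChain_append_cons_cons.1 this).2.1
  | cons b l2 =>
    refine ⟨b, ?_⟩
    have : (p.start :: l1 ++ w :: b :: (l2 ++ [p.rest.getLast hne])).IsChain
        (fun a b => (a, b) ∈ E) := by
      simpa using hc
    exact (List.isChain_append_cons_cons.1 this).2.1

theorem isXYPath_of {E : Set (V × V)} {X Y : Set V}
    (hX : ∀ e ∈ E, e.2 ∉ X) (hY : ∀ e ∈ E, e.1 ∉ Y) (p : Dipath E)
    (h1 : p.start ∈ X) (h2 : p.last ∈ Y) : IsXYPath E X Y p := by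
  refine ⟨h1, h2, fun w hw => ?_⟩
  obtain ⟨⟨a, ha⟩, b, hb⟩ := internal_edges p w hw
  rintro (h | h)
  · exact hX _ ha h
  · exact hY _ hb h

theorem uniq {E : Set (V × V)} {X Y : Set V} {P : Set (Dipath E)} (hP : IsXYSystem E X Y P)
    {p q : Dipath E} (hp : p ∈ P) (hq : q ∈ P) {v : V} (h1 : v ∈ p.support) (h2 : v ∈ q.support) :
    p = q := by
  by_contra h
  exact Set.disjoint_left.1 (hP.2 hp hq h) h1 h2

/-- Strict precedence along a path of the system. -/
def before {E : Set (V × V)} (P : Set (Dipath E)) (v w : V) : Prop :=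
  ∃ p ∈ P, v ∈ p.support ∧ w ∈ p.support ∧ p.verts.idxOf v < p.verts.idxOf w

/-- Immediate precedence along a path of the system. -/
def succ {E : Set (V × V)} (P : Set (Dipath E)) (v w : V) : Prop :=
  ∃ p ∈ P, v ∈ p.support ∧ w ∈ p.support ∧ p.verts.idxOf w = p.verts.idxOf v + 1

theorem linkage {E : Set (V × V)} {X Y : Set V}
    (hX : ∀ e ∈ E, e.2 ∉ X) (hY : ∀ e ∈ E, e.1 ∉ Y)
    (P Q : Set (Dipath E)) (hP : IsXYSystem E X Y P) (hQ : IsXYSystem E X Y Q)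
    (hQX : initVerts Q = X) (n : ℕ) (hn : (X \ initVerts P).encard ≤ n) :
    ∃ R : Set (Dipath E), IsXYSystem E X Y R ∧ initVerts R = X ∧
      ∃ N : Set V, N.encard ≤ n ∧ termVerts R ⊆ termVerts P ∪ N := by
  set VP : Set V := {v | ∃ p ∈ P, v ∈ p.support} with hVPdef
  have htri : ∀ a b c, before P a c → before P b c → a = b ∨ before P a b ∨ before P b a := by
    rintro a b c ⟨p, hp, ha, hc, h1⟩ ⟨q, hq, hb, hc', h2⟩
    obtain rfl := uniq hP hp hq hc hc'
    rcases lt_trichotomy (p.verts.idxOf a) (p.verts.idxOf b) with h | h | h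
    · exact Or.inr (Or.inl ⟨p, hp, ha, hb, h⟩)
    · exact Or.inl ((List.idxOf_inj ha).1 h)
    · exact Or.inr (Or.inr ⟨p, hp, hb, ha, h⟩)
  have htrans : ∀ a b c, before P a b → before P b c → before P a c := by
    rintro a b c ⟨p, hp, ha, hb, h1⟩ ⟨q, hq, hb', hc, h2⟩
    obtain rfl := uniq hP hp hq hb hb'
    exact ⟨p, hp, ha, hc, h1.trans h2⟩
  have hirr : ∀ a, ¬ before P a a := by
    rintro a ⟨p, hp, ha, hb, h1⟩
    exact lt_irrefl _ h1
  obtain ⟨C, hXC, hCn, hCs⟩ := exists_stable (succ Q) (before P) VP X hirr htrans htri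
    (by rintro a b ⟨p, hp, ha, hb, h⟩; exact ⟨p, hp, hb⟩) n (by
      refine (Set.encard_le_encard ?_).trans hn
      rintro v ⟨h1, h2, h3⟩
      refine ⟨h1, ?_⟩
      rintro ⟨p, hp, rfl⟩
      rcases h3 with h3 | ⟨w, hw, q, hq, h4, h5, h6⟩
      · exact h3 ⟨p, hp, start_mem p⟩
      · rcases List.mem_cons.1 h5 with h7 | h7
        · rw [h7] at h6
          simp [Dipath.verts] at h6
        · obtain ⟨a, ha⟩ := in_edge q w h7
          exact hX _ ha hw)
  have step : ∀ q ∈ Q, ∃ r : Dipath E, IsXYPath E X Y r ∧ r.start = q.start ∧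
      (r.last ∈ termVerts P ∨ r.last ∈ front (succ Q) (before P) VP C) ∧
      ∃ v ∈ q.support, v ∈ C ∧ ∀ u ∈ r.support, (u ∈ C ∧ u ∈ q.support) ∨
        (u ∉ C ∧ before P v u ∧ ∀ w ∈ C, ¬ before P v w) := by
    intro q hq
    have hsX : q.start ∈ X := (hQ.1 q hq).1
    obtain ⟨l1, v, l2, h1, h2, h3, h4⟩ := split_list C q.rest q.start (hXC hsX)
    have h1 : q.verts = l1 ++ v :: l2 := h1
    have hnd : (l1 ++ v :: l2).Nodup := h1 ▸ nodup' q
    have hvl1 : v ∉ l1 := by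
      intro h
      exact (List.disjoint_of_nodup_append hnd) h (by simp)
    have hvq : v ∈ q.support := by
      change v ∈ q.verts
      simp [h1]
    have hsucc : ∀ w, succ Q v w → w ∉ C := by
      rintro w ⟨q', hq', hv, hw, hi⟩
      obtain rfl := uniq hQ hq hq' hvq hv
      have hw : w ∈ q.verts := hw
      have hlt := List.idxOf_lt_length_of_mem hw
      have hget := List.getElem_idxOf hlt
      have hiv : q.verts.idxOf v = l1.length := by
        rw [h1, List.idxOf_append_of_notMem hvl1]; simp
      cases l2 with
      | nil =>
        rw [hi, hiv, h1] at hlt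
        simp at hlt
      | cons b l2 =>
        have : w = b := by
          have hget' : q.verts[q.verts.idxOf w]? = some w := by
            rw [List.getElem?_eq_getElem hlt, hget]
          rw [hi, hiv, h1, List.getElem?_append_right (by omega)] at hget'
          simpa using hget'.symm
        rw [this]
        exact h4 b l2 rfl
    by_cases hv : v ∈ front (succ Q) (before P) VP C
    · have hl2 : l2 = [] := by
        cases l2 with
        | nil => rfl
        | cons b l2 =>
          exfalso
          refine hCs v hv b ⟨q, hq, hvq, ?_, ?_⟩
          · change b ∈ q.verts
            simp [h1]
          · have hb : b ∉ l1 := fun h => (List.disjoint_of_nodup_append hnd) h (by simp)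
            have hbv : v ≠ b := by
              rintro rfl
              have := hnd.of_append_right
              simp at this
            rw [h1, List.idxOf_append_of_notMem hvl1, List.idxOf_append_of_notMem hb]
            simp [List.idxOf_cons_ne _ hbv]
      subst hl2
      refine ⟨q, hQ.1 q hq, rfl, Or.inr ?_, v, hvq, h3, ?_⟩
      · rw [last_eq q l1 v h1]
        exact hv
      · intro u hu
        refine Or.inl ⟨?_, hu⟩
        have hu' : u ∈ q.verts := hu
        rw [h1] at hu'
        rcases List.mem_append.1 hu' with h | h
        · exact h2 u h
        · obtain rfl := List.mem_singleton.1 h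
          exact h3
    · have hv' : v ∈ VP ∧ ∀ w ∈ C, ¬ before P v w := by
        by_contra hcon
        apply hv
        refine ⟨h3, hsucc, ?_⟩
        by_contra h
        push Not at h
        exact hcon h
      obtain ⟨⟨p, hp, hvp⟩, hmax⟩ := hv'
      obtain ⟨m1, m2, h5⟩ := List.append_of_mem (show v ∈ p.verts from hvp)
      have hndp : (m1 ++ v :: m2).Nodup := h5 ▸ nodup' p
      have hvm1 : v ∉ m1 := by
        intro h
        exact (List.disjoint_of_nodup_append hndp) h (by simp)
      have hm2 : ∀ u ∈ m2, before P v u := by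
        intro u hu
        refine ⟨p, hp, hvp, ?_, ?_⟩
        · change u ∈ p.verts
          simp [h5, hu]
        · have hum : u ∉ m1 := fun h => (List.disjoint_of_nodup_append hndp) h (by simp [hu])
          have hbv : v ≠ u := by
            rintro rfl
            have := hndp.of_append_right
            exact (List.nodup_cons.1 this).1 hu
          rw [h5, List.idxOf_append_of_notMem hvm1, List.idxOf_append_of_notMem hum]
          simp [List.idxOf_cons_ne _ hbv]
      have hm2C : ∀ u ∈ m2, u ∉ C := fun u hu huC => hmax u huC (hm2 u hu)
      obtain ⟨r, hr⟩ := exists_dipath (E := E) (l1 ++ v :: m2) (by simp) (by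
        have c1 := chain' q
        have c2 := chain' p
        rw [h1] at c1
        rw [h5] at c2
        exact List.isChain_split.2 ⟨(List.isChain_split.1 c1).1, (List.isChain_split.1 c2).2⟩) (by
        refine List.nodup_append'.2 ⟨hnd.of_append_left, hndp.of_append_right, ?_⟩
        intro u hu hu'
        rcases List.mem_cons.1 hu' with rfl | h
        · exact hvl1 hu
        · exact hm2C u h (h2 u hu))
      have hstart : r.start = q.start := by
        have e1 : r.verts.head? = some r.start := rfl
        have e2 : q.verts.head? = some q.start := rfl
        rw [hr] at e1
        rw [h1] at e2
        cases l1 with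
        | nil => simp at e1 e2; rw [← e1, ← e2]
        | cons a l1 => simp at e1 e2; rw [← e1, ← e2]
      have hlast : r.last = p.last := by
        have e1 : r.last = r.verts.getLast (by simp [Dipath.verts]) := rfl
        have e2 : p.last = p.verts.getLast (by simp [Dipath.verts]) := rfl
        rw [e1, e2]
        simp only [hr, h5]
        rw [List.getLast_append_of_ne_nil _ (by simp), List.getLast_append_of_ne_nil _ (by simp)]
      refine ⟨r, isXYPath_of hX hY r (hstart ▸ hsX) (hlast ▸ (hP.1 p hp).2.1), hstart,
        Or.inl ⟨p, hp, hlast.symm⟩, v, hvq, h3, ?_⟩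
      intro u hu
      have hu : u ∈ r.verts := hu
      rw [hr] at hu
      rcases List.mem_append.1 hu with h | h
      · refine Or.inl ⟨h2 u h, ?_⟩
        change u ∈ q.verts
        simp [h1, h]
      · rcases List.mem_cons.1 h with rfl | h
        · exact Or.inl ⟨h3, hvq⟩
        · exact Or.inr ⟨hm2C u h, hm2 u h, hmax⟩
  choose! f hf using step
  refine ⟨f '' Q, ⟨?_, ?_⟩, ?_, _, hCn, ?_⟩
  · rintro _ ⟨q, hq, rfl⟩
    exact (hf q hq).1
  · rintro _ ⟨q, hq, rfl⟩ _ ⟨q', hq', rfl⟩ hne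
    have hqq : q ≠ q' := fun h => hne (by rw [h])
    rw [Set.disjoint_left]
    intro u hu hu'
    obtain ⟨-, -, -, v, hv, hvC, h⟩ := hf q hq
    obtain ⟨-, -, -, v', hv', hvC', h'⟩ := hf q' hq'
    rcases h u hu with ⟨a1, a2⟩ | ⟨a1, a2, a3⟩ <;> rcases h' u hu' with ⟨b1, b2⟩ | ⟨b1, b2, b3⟩
    · exact hqq (uniq hQ hq hq' a2 b2)
    · exact b1 a1
    · exact a1 b1
    · rcases htri _ _ _ a2 b2 with h | h | h
      · subst h
        exact hqq (uniq hQ hq hq' hv hv')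
      · exact a3 _ hvC' h
      · exact b3 _ hvC h
  · rw [← hQX]
    ext x
    constructor
    · rintro ⟨_, ⟨q, hq, rfl⟩, rfl⟩
      exact ⟨q, hq, (hf q hq).2.1.symm⟩
    · rintro ⟨q, hq, rfl⟩
      exact ⟨_, ⟨q, hq, rfl⟩, (hf q hq).2.1⟩
  · rintro _ ⟨_, ⟨q, hq, rfl⟩, rfl⟩
    exact (hf q hq).2.2.1

/-- A path of a subgraph seen in the bigger graph. -/
def lift {E' E : Set (V × V)} (h : E' ⊆ E) (p : Dipath E') : Dipath E :=
  ⟨p.start, p.rest, List.IsChain.imp (fun _ _ hab => h hab) p.chain, p.nodup⟩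

theorem lift_injective {E' E : Set (V × V)} (h : E' ⊆ E) : Function.Injective (lift h) := by
  rintro ⟨a, l, _, _⟩ ⟨b, m, _, _⟩ hh
  simp only [lift, Dipath.mk.injEq] at hh
  obtain ⟨rfl, rfl⟩ := hh
  rfl

end Stmt6Aux

open Stmt6Aux

/-- Incompressibility is inherited upwards when restoring finitely many deleted
vertices and finitely many deleted edges. -/
theorem stmt6 {V : Type u} (E : Set (V × V)) (X Y : Set V)
    (hX : ∀ e ∈ E, e.2 ∉ X) (hY : ∀ e ∈ E, e.1 ∉ Y)
    (W : Set V) (hW : W.Finite) (B : Set (V × V)) (hB : B.Finite)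
    (hXW : Disjoint X W) (hYW : Disjoint Y W)
    (hinc : Incompressible {e ∈ E \ B | e.1 ∉ W ∧ e.2 ∉ W} X Y) :
    Incompressible E X Y := by
  classical
  set E' : Set (V × V) := {e ∈ E \ B | e.1 ∉ W ∧ e.2 ∉ W} with hE'
  have hsub : E' ⊆ E := fun e he => he.1.1
  obtain ⟨⟨Q, hQ, hQX⟩, hall⟩ := hinc
  refine ⟨⟨lift hsub '' Q, ⟨?_, ?_⟩, ?_⟩, ?_⟩
  · rintro _ ⟨q, hq, rfl⟩
    exact hQ.1 q hq
  · rintro _ ⟨q, hq, rfl⟩ _ ⟨q', hq', rfl⟩ hne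
    exact hQ.2 hq hq' (fun h => hne (by rw [h]))
  · rw [← hQX, initVerts, Set.image_image]
    rfl
  intro P hP hPX
  have hTY : termVerts P ⊆ Y := by
    rintro _ ⟨p, hp, rfl⟩
    exact (hP.1 p hp).2.1
  by_contra hne
  obtain ⟨y0, hy0, hy0P⟩ : ∃ y ∈ Y, y ∉ termVerts P := by
    by_contra hcon
    push Not at hcon
    exact hne (Set.Subset.antisymm hTY hcon)
  set P' : Set (Dipath E') := {p | lift hsub p ∈ P} with hP'
  set Pb : Set (Dipath E) := {p ∈ P | ∀ p' : Dipath E', lift hsub p' ≠ p} with hPb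
  have hP'sys : IsXYSystem E' X Y P' := by
    refine ⟨fun p hp => hP.1 _ hp, fun p hp q hq hpq => ?_⟩
    exact hP.2 hp hq (fun h => hpq (lift_injective hsub h))
  have hFfin : (W ∪ Prod.fst '' B).Finite := hW.union (hB.image _)
  have hbad : ∀ p ∈ Pb, ∃ v ∈ W ∪ Prod.fst '' B, v ∈ p.support := by
    rintro p ⟨hp, hb⟩
    by_contra hcon
    push Not at hcon
    refine hb ⟨p.start, p.rest, ?_, p.nodup⟩ rfl
    refine List.isChain_iff_forall_rel_of_append_cons_cons.2 ?_
    intro a b l1 l2 hl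
    have hEab := List.isChain_iff_forall_rel_of_append_cons_cons.1 (chain' p) hl
    have ha : a ∈ p.support := by
      change a ∈ p.start :: p.rest
      simp [hl]
    have hb : b ∈ p.support := by
      change b ∈ p.start :: p.rest
      simp [hl]
    exact ⟨⟨hEab, fun h => hcon a (Or.inr ⟨_, h, rfl⟩) ha⟩,
      fun h => hcon a (Or.inl h) ha, fun h => hcon b (Or.inl h) hb⟩
  have : Nonempty V := ⟨y0⟩
  choose! g hgF hgs using hbad
  have hPbfin : Pb.Finite := by
    refine Set.Finite.of_finite_image (f := g) (hFfin.subset ?_) ?_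
    · rintro _ ⟨p, hp, rfl⟩
      exact hgF p hp
    · intro p hp q hq hpq
      exact uniq hP hp.1 hq.1 (hgs p hp) (hpq ▸ hgs q hq)
  have hncard := hPbfin.cast_ncard_eq
  obtain ⟨R, hR, hRX, N, hN, hRN⟩ := linkage (fun e he => hX e (hsub he))
    (fun e he => hY e (hsub he)) P' Q hP'sys hQ hQX Pb.ncard (by
      rw [hncard]
      refine le_trans (Set.encard_le_encard ?_) (Set.encard_image_le Dipath.start Pb)
      rintro x ⟨hx, hx'⟩
      rw [← hPX] at hx
      obtain ⟨p, hp, rfl⟩ := hx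
      refine ⟨p, ⟨hp, ?_⟩, rfl⟩
      rintro p' rfl
      exact hx' ⟨p', hp, rfl⟩)
  have hRY := hall R hR hRX
  rw [hRY] at hRN
  have hinj : Set.InjOn Dipath.last Pb := fun p hp q hq h =>
    uniq hP hp.1 hq.1 (last_mem p) (h ▸ last_mem q)
  have hy0' : y0 ∉ Dipath.last '' Pb := by
    rintro ⟨p, hp, rfl⟩
    exact hy0P ⟨p, hp.1, rfl⟩
  have hsubN : insert y0 (Dipath.last '' Pb) ⊆ N := by
    rintro y (rfl | ⟨p, hp, rfl⟩)
    · refine (hRN hy0).resolve_left ?_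
      rintro ⟨p', hp', rfl⟩
      exact hy0P ⟨_, hp', rfl⟩
    · refine (hRN (hTY ⟨p, hp.1, rfl⟩)).resolve_left ?_
      rintro ⟨p', hp', hl⟩
      have : lift hsub p' = p := uniq hP hp' hp.1 (last_mem (lift hsub p'))
        ((show (lift hsub p').last = p.last from hl) ▸ last_mem p)
      exact hp.2 p' this
  have hcard := (Set.encard_le_encard hsubN).trans hN
  rw [Set.encard_insert_of_notMem hy0', hinj.encard_image, ← hncard] at hcard
  have : Pb.ncard + 1 ≤ Pb.ncard := by exact_mod_cast hcard
  omega
end
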